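/- arXiv:2506.07409 — 3 statements merged into one kernel-verified Lean document; each statement's English description precedes it below -/
import Mathlib

section
/- Let H be a finite-dimensional Hopf algebra with antipode S, normalized integrals λ ∈ H* (right cointegral), Λ ∈ H (left integral), λ(Λ) = 1, and let F be a 2-cocycle of H with Drinfeld element u and S_F(h) = uS(h)u⁻¹. Then for every n > 0 and every k-linear map Y : H^{⊗(n-1)} → H: λ(S(Λ₍₂₎) · S_F(Y(Δ_F^{n-1}(Λ₍₁₎)))) = λ(S( m ∘ (id ⊗ Y ⊗ id)( (1 ⊗ F_n)·(1 ⊗ Δⁿ(Λ))·(F_n⁻¹ ⊗ 1) ) )), where m multiplies the three remaining tensor factors of H. -/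
/-!
STATEMENT 11 (Lemma `l:t1`):
Let H be a finite-dimensional Hopf algebra with antipode S, normalized integrals λ, Λ,
F a 2-cocycle with Drinfeld element u and S_F(h) = u S(h) u⁻¹.  For every n ≥ 2
(written n = p + 2) and every k-linear map Y : H^{⊗(n-1)} → H:
  λ(S(Λ₍₂₎) · S_F(Y(Δ_F^{n-1}(Λ₍₁₎))))
    = λ(S( m ∘ (id ⊗ Y ⊗ id)( (1 ⊗ F_n)·(1 ⊗ Δⁿ(Λ))·(F_n⁻¹ ⊗ 1) ) )).
The Sweedler components Λ₍₁₎, Λ₍₂₎ are encoded by a finite-sum representation of Δ(Λ).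
-/

open TensorProduct

structure AlgBundle (k : Type) [CommRing k] where
  carrier : Type
  ring : Ring carrier
  alg : @Algebra k carrier _ ring.toSemiring

section
variable (k H : Type) [Field k] [Ring H] [HopfAlgebra k H]

noncomputable def tpowB : ℕ → AlgBundle k
  | 0 => ⟨H, inferInstance, inferInstance⟩
  | n + 1 =>
      letI := (tpowB n).ring
      letI := (tpowB n).alg
      ⟨TensorProduct k H (tpowB n).carrier, inferInstance, inferInstance⟩

/-- `Tpow k H n` is the (n+1)-fold tensor power `H ⊗ (H ⊗ (⋯ ⊗ H))`. -/
noncomputable def Tpow (n : ℕ) : Type := (tpowB k H n).carrier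

noncomputable instance instTpowRing (n : ℕ) : Ring (Tpow k H n) := (tpowB k H n).ring
noncomputable instance instTpowAlgebra (n : ℕ) : Algebra k (Tpow k H n) := (tpowB k H n).alg

/-- The iterated comultiplication `Δ^{n+1} : H → H^{⊗(n+1)}`. -/
noncomputable def comulIter : ∀ n : ℕ, H →ₗ[k] Tpow k H n
  | 0 => LinearMap.id
  | n + 1 =>
      show H →ₗ[k] TensorProduct k H (Tpow k H n) from
        (TensorProduct.map LinearMap.id (comulIter n)) ∘ₗ Coalgebra.comul

/-- The higher twists of `F`:  `Fseq F n = F_{n+1}`. -/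
noncomputable def Fseq (F : H ⊗[k] H) : ∀ n : ℕ, Tpow k H n
  | 0 => 1
  | n + 1 =>
      show TensorProduct k H (Tpow k H n) from
        ((1 : H) ⊗ₜ[k] Fseq F n) * (TensorProduct.map LinearMap.id (comulIter k H n) F)

/-- Cast between tensor powers of equal length. -/
noncomputable def tcast {a b : ℕ} (h : a = b) : Tpow k H a ≃ₗ[k] Tpow k H b :=
  h ▸ LinearEquiv.refl k (Tpow k H a)

/-- The canonical identification `H^{⊗(a+1)} ⊗ H^{⊗(b+1)} ≅ H^{⊗(a+b+2)}`. -/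
noncomputable def concEquiv : ∀ a b : ℕ, (Tpow k H a ⊗[k] Tpow k H b) ≃ₗ[k] Tpow k H (a + 1 + b)
  | 0, b =>
      (show (Tpow k H 0 ⊗[k] Tpow k H b) ≃ₗ[k] Tpow k H (b + 1) from
        LinearEquiv.refl k (Tpow k H 0 ⊗[k] Tpow k H b)).trans (tcast k H (by omega))
  | a + 1, b =>
      (show (Tpow k H (a+1) ⊗[k] Tpow k H b) ≃ₗ[k] H ⊗[k] (Tpow k H a ⊗[k] Tpow k H b) from
        TensorProduct.assoc k H (Tpow k H a) (Tpow k H b)).trans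
      ((TensorProduct.congr (LinearEquiv.refl k H) (concEquiv a b)).trans
        ((show (TensorProduct k H (Tpow k H (a + 1 + b))) ≃ₗ[k] Tpow k H (a + 1 + b + 1) from
            LinearEquiv.refl k _).trans (tcast k H (by omega))))


/-- The canonical identification `H^{⊗(n+1)} ⊗ H ≅ H^{⊗(n+2)}`. -/
noncomputable def snocEquiv : ∀ n : ℕ, (Tpow k H n ⊗[k] H) ≃ₗ[k] Tpow k H (n + 1)
  | 0 => LinearEquiv.refl k (TensorProduct k H H)
  | n + 1 =>
      show (TensorProduct k H (Tpow k H n)) ⊗[k] H ≃ₗ[k] TensorProduct k H (Tpow k H (n+1)) from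
        (TensorProduct.assoc k H (Tpow k H n) H).trans
          (TensorProduct.congr (LinearEquiv.refl k H) (snocEquiv n))

/-- The twisted comultiplication `Δ_F(h) = F Δ(h) F⁻¹`. -/
noncomputable def comulF (F F' : H ⊗[k] H) : H →ₗ[k] H ⊗[k] H :=
  (LinearMap.mulRight k F') ∘ₗ (LinearMap.mulLeft k F) ∘ₗ Coalgebra.comul

/-- The iterated twisted comultiplication `Δ_F^{n+1}`. -/
noncomputable def comulIterF (F F' : H ⊗[k] H) : ∀ n : ℕ, H →ₗ[k] Tpow k H n
  | 0 => LinearMap.id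
  | n + 1 =>
      show H →ₗ[k] TensorProduct k H (Tpow k H n) from
        (TensorProduct.map LinearMap.id (comulIterF F F' n)) ∘ₗ comulF k H F F'

end


section partOne
variable {k H : Type} [Field k] [Ring H] [HopfAlgebra k H]

/-- The shift property of a left integral. -/
lemma integral_shift (Λ : H)
    (hΛ : ∀ h : H, h * Λ = Coalgebra.counit (R := k) h • Λ)
    {m : ℕ} (a b : Fin m → H)
    (hrep : Coalgebra.comul (R := k) Λ = ∑ i, a i ⊗ₜ[k] b i) (h : H) :
    ∑ i, (h * a i) ⊗ₜ[k] (HopfAlgebra.antipode k (b i)) =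
      ∑ i, (a i) ⊗ₜ[k] (HopfAlgebra.antipode k (b i) * h) := by
  let L : H ⊗[k] (H ⊗[k] H) →ₗ[k] H ⊗[k] H :=
    ∑ i, TensorProduct.map (LinearMap.mulRight k (a i))
      (LinearMap.mulLeft k (HopfAlgebra.antipode k (b i)) ∘ₗ
        LinearMap.mul' k H ∘ₗ (HopfAlgebra.antipode k).rTensor H)
  have hL : ∀ x y, L (x ⊗ₜ y) = ∑ i, (x * a i) ⊗ₜ[k] (HopfAlgebra.antipode k (b i) *
      LinearMap.mul' k H ((HopfAlgebra.antipode k).rTensor H y)) := by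
    intro x y
    simp [L]
  have e1 : ∀ t : H ⊗[k] H, L ((Coalgebra.comul (R := k)).lTensor H t) =
      ∑ i, (TensorProduct.rid k H ((Coalgebra.counit (R := k)).lTensor H t) * a i) ⊗ₜ[k]
        HopfAlgebra.antipode k (b i) := by
    intro t
    induction t with
    | zero => simp
    | add x y hx hy => simp [hx, hy, add_mul, TensorProduct.add_tmul, Finset.sum_add_distrib]
    | tmul x y =>
      simp only [LinearMap.lTensor_tmul, hL, HopfAlgebra.mul_antipode_rTensor_comul_apply]
      simp [Algebra.algebraMap_eq_smul_one, TensorProduct.smul_tmul']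
  have e2 : ∀ (t : H ⊗[k] H) (z : H), L (TensorProduct.assoc k H H H (t ⊗ₜ z)) =
      TensorProduct.map LinearMap.id (LinearMap.mulRight k z)
      ((HopfAlgebra.antipode k).lTensor H (t * Coalgebra.comul (R := k) Λ)) := by
    intro t z
    rw [hrep]
    induction t with
    | zero => simp
    | add x y hx hy => simp only [add_mul, map_add, TensorProduct.add_tmul, hx, hy]
    | tmul x y =>
      rw [TensorProduct.assoc_tmul, hL]
      simp [Finset.mul_sum, HopfAlgebra.antipode_mul_antidistrib, mul_assoc]
  have e3 : ∀ t : H ⊗[k] H, L (TensorProduct.assoc k H H H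
        ((Coalgebra.comul (R := k)).rTensor H t)) =
      ∑ i, a i ⊗ₜ[k] (HopfAlgebra.antipode k (b i) *
        TensorProduct.lid k H ((Coalgebra.counit (R := k)).rTensor H t)) := by
    intro t
    induction t with
    | zero => simp
    | add x y hx hy => simp [hx, hy, mul_add, TensorProduct.tmul_add, Finset.sum_add_distrib]
    | tmul x y =>
      rw [LinearMap.rTensor_tmul, e2, ← Bialgebra.comul_mul, hΛ, map_smul, hrep]
      simp [Finset.smul_sum]
  have := e3 (Coalgebra.comul h)
  rw [Coalgebra.coassoc_apply, e1] at this
  simpa using this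

/-- `λ(h Λ₁) S(Λ₂) = h`. -/
lemma frobenius_left (lam : H →ₗ[k] k) (Λ : H)
    (hΛ : ∀ h : H, h * Λ = Coalgebra.counit (R := k) h • Λ)
    (hlam : ∀ h : H,
      (TensorProduct.lid k H) ((TensorProduct.map lam LinearMap.id)
        (Coalgebra.comul (R := k) h)) = lam h • (1 : H))
    (hnorm : lam Λ = 1)
    {m : ℕ} (a b : Fin m → H)
    (hrep : Coalgebra.comul (R := k) Λ = ∑ i, a i ⊗ₜ[k] b i) (h : H) :
    ∑ i, lam (h * a i) • HopfAlgebra.antipode k (b i) = h := by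
  have h1 := congrArg (fun t => TensorProduct.lid k H (TensorProduct.map lam LinearMap.id t))
    (integral_shift Λ hΛ a b hrep h)
  have h2 := hlam Λ
  rw [hrep, hnorm] at h2
  simp only [map_sum, TensorProduct.map_tmul, TensorProduct.lid_tmul, LinearMap.id_apply,
    one_smul] at h1 h2
  rw [h1]
  have h3 := congrArg (fun t => HopfAlgebra.antipode k t * h) h2
  simpa [Finset.sum_mul] using h3

/-- `λ(S(Λ₂) h) Λ₁ = h`. -/
lemma frobenius_right [FiniteDimensional k H] (lam : H →ₗ[k] k) (Λ : H)
    (hΛ : ∀ h : H, h * Λ = Coalgebra.counit (R := k) h • Λ)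
    (hlam : ∀ h : H,
      (TensorProduct.lid k H) ((TensorProduct.map lam LinearMap.id)
        (Coalgebra.comul (R := k) h)) = lam h • (1 : H))
    (hnorm : lam Λ = 1)
    {m : ℕ} (a b : Fin m → H)
    (hrep : Coalgebra.comul (R := k) Λ = ∑ i, a i ⊗ₜ[k] b i) (h : H) :
    ∑ i, lam (HopfAlgebra.antipode k (b i) * h) • a i = h := by
  have hl := frobenius_left lam Λ hΛ hlam hnorm a b hrep
  let B : H →ₗ[k] Module.Dual k H := (LinearMap.mul k H).compr₂ lam
  have hB : ∀ x y, B x y = lam (x * y) := fun x y => rfl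
  have hinj : Function.Injective B := by
    rw [injective_iff_map_eq_zero]
    intro x hx
    rw [← hl x]
    refine Finset.sum_eq_zero fun i _ => ?_
    rw [← hB, hx]
    simp
  have hsurj : Function.Surjective B :=
    (LinearMap.injective_iff_surjective_of_finrank_eq_finrank
      (Subspace.dual_finrank_eq (K := k) (V := H)).symm).1 hinj
  rw [← sub_eq_zero, ← Module.forall_dual_apply_eq_zero_iff k]
  intro φ
  obtain ⟨x, rfl⟩ := hsurj φ
  rw [map_sub, sub_eq_zero, map_sum]
  conv_rhs => rw [hB, ← hl x]
  simp only [map_smul, hB, Finset.sum_mul, map_sum, smul_mul_assoc, mul_smul_comm, smul_eq_mul]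
  exact Finset.sum_congr rfl fun i _ => mul_comm _ _

lemma trace_formula [FiniteDimensional k H] (lam : H →ₗ[k] k)
    {m : ℕ} (a d : Fin m → H) (hr : ∀ h, ∑ i, lam (d i * h) • a i = h) (T : H →ₗ[k] H) :
    ∑ i, lam (d i * T (a i)) = LinearMap.trace k H T := by
  have : T = ∑ i, (lam ∘ₗ LinearMap.mulLeft k (d i)).smulRight (T (a i)) := by
    ext x
    conv_lhs => rw [← hr x]
    simp
  conv_rhs => rw [this]
  rw [map_sum]
  simp

/-- The core identity. -/
lemma core_identity [FiniteDimensional k H] (lam : H →ₗ[k] k) (Λ : H)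
    (hΛ : ∀ h : H, h * Λ = Coalgebra.counit (R := k) h • Λ)
    (hlam : ∀ h : H,
      (TensorProduct.lid k H) ((TensorProduct.map lam LinearMap.id)
        (Coalgebra.comul (R := k) h)) = lam h • (1 : H))
    (hnorm : lam Λ = 1)
    {m : ℕ} (a b : Fin m → H)
    (hrep : Coalgebra.comul (R := k) Λ = ∑ i, a i ⊗ₜ[k] b i)
    {r q : ℕ} (f f' : Fin r → H) (g g' : Fin q → H) (Z : H →ₗ[k] H) :
    ∑ l, ∑ j, ∑ i, lam (HopfAlgebra.antipode k
        (g l * (Z (f j * a i * g' l) * (f' j * b i)))) =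
      ∑ i, lam (HopfAlgebra.antipode k (b i) *
        ((∑ j, f j * HopfAlgebra.antipode k (f' j)) * HopfAlgebra.antipode k (Z (a i)) *
          ∑ l, HopfAlgebra.antipode k (g l) * g' l)) := by
  set S := HopfAlgebra.antipode k (A := H) with hS
  set u := ∑ j, f j * S (f' j) with hu
  have hr := frobenius_right lam Λ hΛ hlam hnorm a b hrep
  have s1 : ∀ l j, ∑ i, lam (S (g l * (Z (f j * a i * g' l) * (f' j * b i)))) =
      ∑ i, lam (S (b i) * (f j * S (f' j) * S (Z (a i * g' l)) * S (g l))) := by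
    intro l j
    let Ψ : H ⊗[k] H →ₗ[k] k := lam ∘ₗ LinearMap.mul' k H ∘ₗ
      (TensorProduct.map LinearMap.id
        (LinearMap.mulRight k (S (g l)) ∘ₗ LinearMap.mulLeft k (S (f' j)) ∘ₗ S ∘ₗ Z ∘ₗ
          LinearMap.mulRight k (g' l))) ∘ₗ (TensorProduct.comm k H H).toLinearMap
    have := congrArg Ψ (integral_shift Λ hΛ a b hrep (f j))
    simp only [map_sum] at this
    simp only [hS, HopfAlgebra.antipode_mul_antidistrib]
    simpa [Ψ, mul_assoc] using this
  have s2 : ∀ l, ∑ j, ∑ i, lam (S (g l * (Z (f j * a i * g' l) * (f' j * b i)))) =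
      ∑ i, lam (S (b i) * (u * S (Z (a i)) * (S (g l) * g' l))) := by
    intro l
    simp only [s1]
    rw [Finset.sum_comm]
    have e : ∀ i, ∑ j, lam (S (b i) * (f j * S (f' j) * S (Z (a i * g' l)) * S (g l))) =
        lam (S (b i) * (((LinearMap.mulRight k (S (g l)) ∘ₗ LinearMap.mulLeft k u ∘ₗ S ∘ₗ Z) ∘ₗ
          LinearMap.mulRight k (g' l)) (a i))) := by
      intro i
      simp [hu, Finset.sum_mul, Finset.mul_sum]
    simp only [e]
    rw [trace_formula lam a (fun i => S (b i)) hr, LinearMap.trace_comp_comm',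
      ← trace_formula lam a (fun i => S (b i)) hr]
    simp [mul_assoc]
  simp only [s2]
  rw [Finset.sum_comm]
  simp [Finset.mul_sum]

/-- The Drinfeld element is invertible: `v u = 1`. -/
lemma drinfeld_inv (F F' : H ⊗[k] H)
    (hinv₁ : F * F' = 1) (hinv₂ : F' * F = 1)
    (hcu₁ : (TensorProduct.lid k H)
      ((TensorProduct.map (Coalgebra.counit (R := k)) LinearMap.id) F) = 1)
    (hcu₂ : (TensorProduct.rid k H)
      ((TensorProduct.map LinearMap.id (Coalgebra.counit (R := k))) F) = 1)
    (hcoc : ((1 : H) ⊗ₜ[k] F) *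
        (TensorProduct.map LinearMap.id (Coalgebra.comul (R := k)) F) =
      (TensorProduct.assoc k H H H)
        ((F ⊗ₜ[k] (1 : H)) *
          (TensorProduct.map (Coalgebra.comul (R := k)) LinearMap.id F))) :
    LinearMap.mul' k H (TensorProduct.map (HopfAlgebra.antipode k) LinearMap.id F') *
      LinearMap.mul' k H (TensorProduct.map LinearMap.id (HopfAlgebra.antipode k) F) = 1 := by
  let as := Algebra.TensorProduct.assoc k k k H H H
  let dl : H ⊗[k] H →ₐ[k] H ⊗[k] (H ⊗[k] H) := as.toAlgHom.comp
    (Algebra.TensorProduct.map (Bialgebra.comulAlgHom k H) (AlgHom.id k H))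
  let dr : H ⊗[k] H →ₐ[k] H ⊗[k] (H ⊗[k] H) :=
    (Algebra.TensorProduct.map (AlgHom.id k H) (Bialgebra.comulAlgHom k H))
  let il : H ⊗[k] H →ₐ[k] H ⊗[k] (H ⊗[k] H) := as.toAlgHom.comp
    Algebra.TensorProduct.includeLeft
  let ir : H ⊗[k] H →ₐ[k] H ⊗[k] (H ⊗[k] H) := Algebra.TensorProduct.includeRight
  have hc : ir F * dr F = il F * dl F := by
    refine hcoc.trans ?_
    exact map_mul as _ _
  have h2 : il F' * ir F = dl F * dr F' := by
    have e1 : il F' * il F = 1 := by rw [← map_mul, hinv₂, map_one]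
    have e2 : dr F * dr F' = 1 := by rw [← map_mul, hinv₁, map_one]
    calc il F' * ir F = il F' * (ir F * dr F) * dr F' := by
          rw [mul_assoc, mul_assoc, e2, mul_one]
      _ = dl F * dr F' := by rw [hc, ← mul_assoc, e1, one_mul]
  let S := HopfAlgebra.antipode k (A := H)
  let Φ : H ⊗[k] (H ⊗[k] H) →ₗ[k] H := LinearMap.mul' k H ∘ₗ
    TensorProduct.map S (LinearMap.mul' k H ∘ₗ TensorProduct.map LinearMap.id S)
  have l1 : ∀ X Y : H ⊗[k] H, Φ (il X * ir Y) =
      LinearMap.mul' k H (TensorProduct.map S LinearMap.id X) *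
      LinearMap.mul' k H (TensorProduct.map LinearMap.id S Y) := by
    intro X Y
    induction X with
    | zero => simp
    | add x y hx hy => simp only [map_add, add_mul, hx, hy]
    | tmul x x' =>
      induction Y with
      | zero => simp
      | add x y hx hy => simp only [map_add, mul_add, hx, hy]
      | tmul y y' => simp [Φ, il, ir, as, S, mul_assoc]
  have l2 : ∀ (A B : H ⊗[k] H) (x y : H),
      Φ (as (A ⊗ₜ x) * (y ⊗ₜ B)) = S y * (LinearMap.mul' k H (S.rTensor H A) *
        LinearMap.mul' k H (S.lTensor H B)) * S x := by
    intro A B x y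
    induction A with
    | zero => simp
    | add s t hs ht => simp only [map_add, add_mul, mul_add, TensorProduct.add_tmul, hs, ht]
    | tmul s s' =>
      induction B with
      | zero => simp
      | add s t hs ht => simp only [map_add, add_mul, mul_add, TensorProduct.tmul_add, hs, ht]
      | tmul t t' =>
        simp [Φ, as, S, mul_assoc, HopfAlgebra.antipode_mul_antidistrib]
  have l3 : ∀ X Y : H ⊗[k] H, Φ (dl X * dr Y) =
      S (TensorProduct.rid k H (TensorProduct.map LinearMap.id (Coalgebra.counit (R := k)) Y)) *
      S (TensorProduct.lid k H (TensorProduct.map (Coalgebra.counit (R := k)) LinearMap.id X)) := by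
    intro X Y
    induction X with
    | zero => simp
    | add x y hx hy => simp only [map_add, add_mul, mul_add, hx, hy]
    | tmul x x' =>
      induction Y with
      | zero => simp
      | add x y hx hy => simp only [map_add, add_mul, mul_add, hx, hy]
      | tmul y y' =>
        have : dl (x ⊗ₜ x') * dr (y ⊗ₜ y') = as (Coalgebra.comul (R := k) x ⊗ₜ x') *
          (y ⊗ₜ Coalgebra.comul (R := k) y') := rfl
        rw [this, l2]
        simp only [S, HopfAlgebra.mul_antipode_rTensor_comul_apply,
          HopfAlgebra.mul_antipode_lTensor_comul_apply]
        simp [Algebra.algebraMap_eq_smul_one, smul_smul, mul_comm]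
  have hcu' : (TensorProduct.rid k H)
      ((TensorProduct.map LinearMap.id (Coalgebra.counit (R := k))) F') = 1 := by
    let E : H ⊗[k] H →ₐ[k] H := (Algebra.TensorProduct.rid k k H).toAlgHom.comp
      (Algebra.TensorProduct.map (AlgHom.id k H) (Bialgebra.counitAlgHom k H))
    have hE : ∀ X, E X = (TensorProduct.rid k H)
      ((TensorProduct.map LinearMap.id (Coalgebra.counit (R := k))) X) := fun X => rfl
    have e := congrArg E hinv₁
    rw [map_mul, map_one, hE F, hcu₂, one_mul] at e
    exact e
  have := l1 F' F
  rw [h2, l3, hcu', hcu₁] at this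
  rw [← this]
  simp [S]

end partOne

section partTwo
variable (k H : Type) [Field k] [Ring H] [HopfAlgebra k H]

/-- The iterated comultiplication as an algebra homomorphism. -/
noncomputable def comulAlg : ∀ n : ℕ, H →ₐ[k] Tpow k H n
  | 0 => AlgHom.id k H
  | n + 1 =>
      show H →ₐ[k] TensorProduct k H (Tpow k H n) from
        (Algebra.TensorProduct.map (AlgHom.id k H) (comulAlg n)).comp (Bialgebra.comulAlgHom k H)

lemma comulAlg_toLinearMap (n : ℕ) : (comulAlg k H n).toLinearMap = comulIter k H n := by
  induction n with
  | zero => rfl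
  | succ n ih =>
    show (TensorProduct.map LinearMap.id (comulAlg k H n).toLinearMap) ∘ₗ Coalgebra.comul = 
      (TensorProduct.map LinearMap.id (comulIter k H n)) ∘ₗ Coalgebra.comul
    rw [ih]

/-- `snocEquiv` as an algebra isomorphism. -/
noncomputable def snocAlg : ∀ n : ℕ, (Tpow k H n ⊗[k] H) ≃ₐ[k] Tpow k H (n + 1)
  | 0 => (AlgEquiv.refl : TensorProduct k H H ≃ₐ[k] TensorProduct k H H)
  | n + 1 =>
      show (TensorProduct k H (Tpow k H n)) ⊗[k] H ≃ₐ[k] TensorProduct k H (Tpow k H (n+1)) from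
        (Algebra.TensorProduct.assoc k k k H (Tpow k H n) H).trans
          (Algebra.TensorProduct.congr AlgEquiv.refl (snocAlg n))

lemma snocAlg_toLinearEquiv (n : ℕ) : (snocAlg k H n).toLinearEquiv = snocEquiv k H n := by
  induction n with
  | zero => rfl
  | succ n ih =>
    show (TensorProduct.assoc k H (Tpow k H n) H).trans
          (TensorProduct.congr (LinearEquiv.refl k H) (snocAlg k H n).toLinearEquiv) =
      (TensorProduct.assoc k H (Tpow k H n) H).trans
          (TensorProduct.congr (LinearEquiv.refl k H) (snocEquiv k H n))
    rw [ih]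

lemma snocAlg_apply (n : ℕ) (x) : snocAlg k H n x = snocEquiv k H n x := by
  rw [← snocAlg_toLinearEquiv]; rfl

lemma comulIter_eq (n : ℕ) (x) : comulIter k H n x = comulAlg k H n x := by
  rw [← comulAlg_toLinearMap]; rfl

lemma snocAlg_succ (n : ℕ) (x : H) (y : Tpow k H n) (z : H) :
    snocAlg k H (n + 1) ((x ⊗ₜ[k] y : TensorProduct k H (Tpow k H n)) ⊗ₜ[k] z) =
      (x ⊗ₜ[k] (snocAlg k H n (y ⊗ₜ[k] z)) : TensorProduct k H (Tpow k H (n + 1))) := rfl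



/-- The algebra map `id ⊗ Δ^n`. -/
noncomputable def idD (n : ℕ) : H ⊗[k] H →ₐ[k] TensorProduct k H (Tpow k H n) :=
  Algebra.TensorProduct.map (AlgHom.id k H) (comulAlg k H n)

/-- The algebra map `Δ^n ⊗ id`, with values in the flattened tensor power. -/
noncomputable def Did (n : ℕ) : H ⊗[k] H →ₐ[k] Tpow k H (n + 1) :=
  (snocAlg k H n).toAlgHom.comp
    (Algebra.TensorProduct.map (comulAlg k H n) (AlgHom.id k H))

lemma Did_tmul (n : ℕ) (x y : H) :
    Did k H n (x ⊗ₜ y) = snocAlg k H n (comulAlg k H n x ⊗ₜ y) := rfl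

lemma idD_tmul (n : ℕ) (x y : H) :
    idD k H n (x ⊗ₜ y) = x ⊗ₜ comulAlg k H n y := rfl

lemma idD_eq (n : ℕ) (t : H ⊗[k] H) :
    TensorProduct.map LinearMap.id (comulIter k H n) t = idD k H n t := by
  rw [← comulAlg_toLinearMap]; rfl

lemma comulAlg_succ (n : ℕ) (x : H) :
    comulAlg k H (n + 1) x = idD k H n (Coalgebra.comul (R := k) x) := rfl

/-- `snocAlg (n+1)` with unfolded types. -/
noncomputable def snocS (n : ℕ) :
    (TensorProduct k H (Tpow k H n)) ⊗[k] H ≃ₐ[k] TensorProduct k H (Tpow k H (n + 1)) :=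
  snocAlg k H (n + 1)

/-- `Did (n+1)` with unfolded types. -/
noncomputable def DidS (n : ℕ) : H ⊗[k] H →ₐ[k] TensorProduct k H (Tpow k H (n + 1)) :=
  Did k H (n + 1)

lemma snoc_tmul_eq (n : ℕ) (w : (H ⊗[k] H) ⊗[k] H) :
    snocS k H n (Algebra.TensorProduct.map (idD k H n) (AlgHom.id k H) w) =
    Algebra.TensorProduct.map (AlgHom.id k H) (Did k H n) (TensorProduct.assoc k H H H w) := by
  induction w with
  | zero => rw [map_zero, map_zero, map_zero, map_zero]
  | add x y hx hy => rw [map_add, map_add, map_add, map_add, ← hx, ← hy]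
  | tmul t z =>
    induction t with
    | zero => rw [TensorProduct.zero_tmul, map_zero, map_zero, map_zero, map_zero]
    | add x y hx hy =>
      rw [TensorProduct.add_tmul, map_add, map_add, map_add, map_add, ← hx, ← hy]
    | tmul x y => rfl

lemma Did_comul (n : ℕ) (x : H) :
    Did k H n (Coalgebra.comul (R := k) x) = comulAlg k H (n + 1) x := by
  induction n generalizing x with
  | zero => rfl
  | succ n ih =>
    have e : (Did k H n).comp (Bialgebra.comulAlgHom k H) = comulAlg k H (n + 1) :=
      AlgHom.ext ih
    have h1 := snoc_tmul_eq k H n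
      ((Coalgebra.comul (R := k)).rTensor H (Coalgebra.comul (R := k) x))
    rw [Coalgebra.coassoc_apply] at h1
    have h2 : ∀ t : H ⊗[k] H, Algebra.TensorProduct.map (AlgHom.id k H) (Did k H n)
        ((Coalgebra.comul (R := k)).lTensor H t) = idD k H (n + 1) t := by
      intro t
      induction t with
      | zero => simp
      | add x y hx hy => simp only [map_add, hx, hy]
      | tmul x y =>
        rw [LinearMap.lTensor_tmul, Algebra.TensorProduct.map_tmul, ih]; rfl
    have h3 : ∀ t : H ⊗[k] H, DidS k H n t = snocS k H n
      (Algebra.TensorProduct.map (idD k H n) (AlgHom.id k H)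
        ((Coalgebra.comul (R := k)).rTensor H t)) := by
      intro t
      induction t with
      | zero => simp
      | add x y hx hy => simp only [map_add, hx, hy]
      | tmul x y => rfl
    exact ((h3 _).trans h1).trans (h2 _)

lemma Fseq_succ (F : H ⊗[k] H) (n : ℕ) :
    Fseq k H F (n + 1) = (((1 : H) ⊗ₜ[k] Fseq k H F n) * idD k H n F :
      TensorProduct k H (Tpow k H n)) := by
  rw [← idD_eq]; rfl

lemma Fseq_succ' (F : H ⊗[k] H)
    (hcoc : ((1 : H) ⊗ₜ[k] F) *
        (TensorProduct.map LinearMap.id (Coalgebra.comul (R := k)) F) =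
      (TensorProduct.assoc k H H H)
        ((F ⊗ₜ[k] (1 : H)) *
          (TensorProduct.map (Coalgebra.comul (R := k)) LinearMap.id F))) (n : ℕ) :
    Fseq k H F (n + 1) = snocAlg k H n (Fseq k H F n ⊗ₜ[k] (1 : H)) * Did k H n F := by
  induction n with
  | zero =>
    rw [Fseq_succ]
    rfl
  | succ n ih =>
    have e : (Did k H n).comp (Bialgebra.comulAlgHom k H) = comulAlg k H (n + 1) :=
      AlgHom.ext (Did_comul k H n)
    let Q : H ⊗[k] (H ⊗[k] H) →ₐ[k] TensorProduct k H (Tpow k H (n + 1)) :=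
      Algebra.TensorProduct.map (AlgHom.id k H) (Did k H n)
    have hQ1 : ∀ t : H ⊗[k] H, Q (TensorProduct.map LinearMap.id (Coalgebra.comul (R := k)) t) =
        idD k H (n + 1) t := by
      intro t
      induction t with
      | zero => simp
      | add x y hx hy => simp only [map_add, hx, hy]
      | tmul x y =>
        rw [TensorProduct.map_tmul]
        show _ ⊗ₜ Did k H n (Coalgebra.comul (R := k) y) = _
        rw [Did_comul]; rfl
    let R : (H ⊗[k] H) ⊗[k] H →ₐ[k] (TensorProduct k H (Tpow k H n)) ⊗[k] H :=
      Algebra.TensorProduct.map (idD k H n) (AlgHom.id k H)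
    have hsn : ∀ w, Q (TensorProduct.assoc k H H H w) = snocS k H n (R w) :=
      fun w => (snoc_tmul_eq k H n w).symm
    have hR : ∀ t : H ⊗[k] H, snocS k H n (R (TensorProduct.map (Coalgebra.comul (R := k))
        LinearMap.id t)) = DidS k H n t := by
      intro t
      induction t with
      | zero => simp
      | add x y hx hy => simp only [map_add, hx, hy]
      | tmul x y => rfl
    have hc := congrArg Q hcoc
    rw [map_mul, hQ1, hsn, map_mul, map_mul, hR] at hc
    have s1 : (1 : H) ⊗ₜ[k] (snocAlg k H n (Fseq k H F n ⊗ₜ[k] (1 : H)) * Did k H n F) =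
      ((1 : H) ⊗ₜ[k] snocAlg k H n (Fseq k H F n ⊗ₜ[k] (1 : H))) * Q ((1 : H) ⊗ₜ F) := by
      show _ = ((1 : H) ⊗ₜ[k] snocAlg k H n (Fseq k H F n ⊗ₜ[k] (1 : H))) *
        ((1 : H) ⊗ₜ Did k H n F)
      rw [Algebra.TensorProduct.tmul_mul_tmul, one_mul]
    have s2 : (1 : H) ⊗ₜ[k] snocAlg k H n (Fseq k H F n ⊗ₜ[k] (1 : H)) =
      snocS k H n (((1 : H) ⊗ₜ[k] Fseq k H F n) ⊗ₜ[k] (1 : H)) := rfl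
    have s3 : R (F ⊗ₜ (1 : H)) = idD k H n F ⊗ₜ (1 : H) := rfl
    have s4 : (1 : H) ⊗ₜ[k] Fseq k H F (n + 1) * idD k H (n + 1) F =
        snocS k H n ((((1 : H) ⊗ₜ[k] Fseq k H F n) * idD k H n F) ⊗ₜ[k] (1 : H)) *
          DidS k H n F := by
      rw [ih, s1, mul_assoc, hc, ← mul_assoc, s2, s3, ← map_mul,
        Algebra.TensorProduct.tmul_mul_tmul, one_mul]
    rw [← Fseq_succ, ← Fseq_succ] at s4
    exact s4

/-- The inverses of the higher twists. -/
noncomputable def Finv (F' : H ⊗[k] H) : ∀ n : ℕ, Tpow k H n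
  | 0 => 1
  | n + 1 =>
      show TensorProduct k H (Tpow k H n) from
        idD k H n F' * ((1 : H) ⊗ₜ[k] Finv F' n)

lemma Fseq_mul_Finv (F F' : H ⊗[k] H) (h : F * F' = 1) (n : ℕ) :
    Fseq k H F n * Finv k H F' n = 1 := by
  induction n with
  | zero => exact mul_one _
  | succ n ih =>
    rw [Fseq_succ]
    show (((1 : H) ⊗ₜ[k] Fseq k H F n) * idD k H n F) *
      (idD k H n F' * ((1 : H) ⊗ₜ[k] Finv k H F' n)) = (1 : TensorProduct k H (Tpow k H n))
    rw [mul_assoc, ← mul_assoc (idD k H n F), ← map_mul, h, map_one, one_mul,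
      Algebra.TensorProduct.tmul_mul_tmul, ih, one_mul]; rfl

lemma Finv_mul_Fseq (F F' : H ⊗[k] H) (h : F' * F = 1) (n : ℕ) :
    Finv k H F' n * Fseq k H F n = 1 := by
  induction n with
  | zero => exact mul_one _
  | succ n ih =>
    rw [Fseq_succ]
    show (idD k H n F' * ((1 : H) ⊗ₜ[k] Finv k H F' n)) *
      (((1 : H) ⊗ₜ[k] Fseq k H F n) * idD k H n F) = (1 : TensorProduct k H (Tpow k H n))
    rw [mul_assoc, ← mul_assoc ((1 : H) ⊗ₜ[k] Finv k H F' n),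
      Algebra.TensorProduct.tmul_mul_tmul, ih, one_mul, ← Algebra.TensorProduct.one_def,
      one_mul, ← map_mul, h, map_one]

lemma comulIterF_eq (F F' : H ⊗[k] H) (n : ℕ) (x : H) :
    comulIterF k H F F' n x = Fseq k H F n * comulAlg k H n x * Finv k H F' n := by
  induction n generalizing x with
  | zero =>
    show x = 1 * x * 1
    rw [one_mul, mul_one]
  | succ n ih =>
    have h1 : ∀ t : H ⊗[k] H, TensorProduct.map LinearMap.id (comulIterF k H F F' n) t =
      ((1 : H) ⊗ₜ[k] Fseq k H F n) * idD k H n t * ((1 : H) ⊗ₜ[k] Finv k H F' n) := by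
      intro t
      induction t with
      | zero => simp
      | add x y hx hy => simp only [map_add, hx, hy, mul_add, add_mul]
      | tmul x y =>
        rw [TensorProduct.map_tmul, ih, idD_tmul, Algebra.TensorProduct.tmul_mul_tmul,
          Algebra.TensorProduct.tmul_mul_tmul, one_mul, mul_one]
        rfl
    have h2 : comulIterF k H F F' (n + 1) x =
      TensorProduct.map LinearMap.id (comulIterF k H F F' n)
        (F * Coalgebra.comul (R := k) x * F') := rfl
    rw [h2, h1, Fseq_succ, comulAlg_succ, map_mul, map_mul]
    show _ = (((1 : H) ⊗ₜ[k] Fseq k H F n) * idD k H n F) * idD k H n (Coalgebra.comul (R := k) x)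
      * (idD k H n F' * ((1 : H) ⊗ₜ[k] Finv k H F' n))
    simp only [mul_assoc]

end partTwo

section partThree
variable (k H : Type) [Field k] [Ring H] [HopfAlgebra k H]

lemma ring_inverse_Fseq (F F' : H ⊗[k] H) (h₁ : F * F' = 1) (h₂ : F' * F = 1) (n : ℕ) :
    Ring.inverse (Fseq k H F n) = Finv k H F' n :=
  Ring.inverse_unit (⟨Fseq k H F n, Finv k H F' n, Fseq_mul_Finv k H F F' h₁ n,
    Finv_mul_Fseq k H F F' h₂ n⟩ : (Tpow k H n)ˣ)

lemma snoc_Finv (F' : H ⊗[k] H) {q : ℕ} (g g' : Fin q → H) (hF' : F' = ∑ l, g l ⊗ₜ[k] g' l)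
    (p : ℕ) :
    snocS k H p ((idD k H p F' * ((1 : H) ⊗ₜ[k] Finv k H F' p)) ⊗ₜ[k] (1 : H)) =
      ∑ l, g l ⊗ₜ[k] snocAlg k H p ((comulAlg k H p (g' l) * Finv k H F' p) ⊗ₜ[k] (1 : H)) := by
  have : idD k H p F' = ∑ l, g l ⊗ₜ[k] comulAlg k H p (g' l) := by
    rw [hF', map_sum]; rfl
  rw [this, Finset.sum_mul, TensorProduct.sum_tmul, map_sum]
  refine Finset.sum_congr rfl fun l _ => ?_
  rw [Algebra.TensorProduct.tmul_mul_tmul, mul_one]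
  rfl

lemma inner_eq (F F' : H ⊗[k] H)
    (hcoc : ((1 : H) ⊗ₜ[k] F) *
        (TensorProduct.map LinearMap.id (Coalgebra.comul (R := k)) F) =
      (TensorProduct.assoc k H H H)
        ((F ⊗ₜ[k] (1 : H)) *
          (TensorProduct.map (Coalgebra.comul (R := k)) LinearMap.id F)))
    {r : ℕ} (f f' : Fin r → H) (hF : F = ∑ j, f j ⊗ₜ[k] f' j)
    (Λ : H) {m : ℕ} (a b : Fin m → H)
    (hrep : Coalgebra.comul (R := k) Λ = ∑ i, a i ⊗ₜ[k] b i) (p : ℕ) (y : H) :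
    Fseq k H F (p + 1) * comulIter k H (p + 1) Λ *
      snocAlg k H p ((comulAlg k H p y * Finv k H F' p) ⊗ₜ[k] (1 : H)) =
    ∑ j, ∑ i, snocAlg k H p (comulIterF k H F F' p (f j * a i * y) ⊗ₜ[k] (f' j * b i)) := by
  rw [comulIter_eq, ← Did_comul, Fseq_succ' k H F hcoc, hrep]
  have e1 : Did k H p F = ∑ j, snocAlg k H p (comulAlg k H p (f j) ⊗ₜ f' j) := by
    conv_lhs => rw [hF]
    rw [map_sum]; rfl
  have e2 : Did k H p (∑ i, a i ⊗ₜ[k] b i) =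
      ∑ i, snocAlg k H p (comulAlg k H p (a i) ⊗ₜ b i) := by
    rw [map_sum]; rfl
  rw [e1, e2]
  simp only [Finset.mul_sum, Finset.sum_mul]
  rw [Finset.sum_comm]
  refine Finset.sum_congr rfl fun j _ => Finset.sum_congr rfl fun i _ => ?_
  rw [comulIterF_eq]
  simp only [← map_mul, Algebra.TensorProduct.tmul_mul_tmul, one_mul, mul_one]
  simp only [map_mul, mul_assoc]

end partThree

theorem statement11
    (k H : Type) [Field k] [Ring H] [HopfAlgebra k H] [FiniteDimensional k H]
    (S : H →ₗ[k] H) (hS : S = HopfAlgebra.antipode (R := k))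
    (lam : H →ₗ[k] k) (Λ : H)
    (hΛ : ∀ h : H, h * Λ = Coalgebra.counit (R := k) h • Λ)
    (hlam : ∀ h : H,
      (TensorProduct.lid k H) ((TensorProduct.map lam LinearMap.id)
        (Coalgebra.comul (R := k) h)) = lam h • (1 : H))
    (hnorm : lam Λ = 1)
    (F F' : H ⊗[k] H)
    (hinv₁ : F * F' = 1) (hinv₂ : F' * F = 1)
    (hcu₁ : (TensorProduct.lid k H)
      ((TensorProduct.map (Coalgebra.counit (R := k)) LinearMap.id) F) = 1)
    (hcu₂ : (TensorProduct.rid k H)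
      ((TensorProduct.map LinearMap.id (Coalgebra.counit (R := k))) F) = 1)
    (hcoc : ((1 : H) ⊗ₜ[k] F) *
        (TensorProduct.map LinearMap.id (Coalgebra.comul (R := k)) F) =
      (TensorProduct.assoc k H H H)
        ((F ⊗ₜ[k] (1 : H)) *
          (TensorProduct.map (Coalgebra.comul (R := k)) LinearMap.id F)))
    (u : H) (hu : u = LinearMap.mul' k H ((TensorProduct.map LinearMap.id S) F))
    (SF : H →ₗ[k] H)
    (hSF : SF = (LinearMap.mulRight k (Ring.inverse u)) ∘ₗ (LinearMap.mulLeft k u) ∘ₗ S)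
    -- n = p + 2 and Y : H^{⊗(n-1)} → H :
    (p : ℕ) (Y : Tpow k H p →ₗ[k] H)
    -- a finite-sum representation Δ(Λ) = Σᵢ a i ⊗ b i :
    (m : ℕ) (a b : Fin m → H)
    (hrep : Coalgebra.comul (R := k) Λ = ∑ i, a i ⊗ₜ[k] b i) :
    (∑ i, lam (S (b i) * SF (Y (comulIterF k H F F' p (a i))))) =
      lam (S
        ((LinearMap.mul' k H ∘ₗ TensorProduct.map LinearMap.id (LinearMap.mul' k H))
          ((TensorProduct.map LinearMap.id
              ((TensorProduct.map Y LinearMap.id) ∘ₗ (snocEquiv k H p).symm.toLinearMap) :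
              TensorProduct k H (Tpow k H (p + 1)) →ₗ[k] TensorProduct k H (H ⊗[k] H))
            ((((1 : H) ⊗ₜ[k] Fseq k H F (p + 1) : TensorProduct k H (Tpow k H (p + 1))) *
              ((1 : H) ⊗ₜ[k] comulIter k H (p + 1) Λ : TensorProduct k H (Tpow k H (p + 1))) *
              (show TensorProduct k H (Tpow k H (p + 1)) from
                snocEquiv k H (p + 1)
                  (Ring.inverse (Fseq k H F (p + 1)) ⊗ₜ[k] (1 : H)))))))) := by
  subst hS
  obtain ⟨r, f, f', hF⟩ := TensorProduct.exists_sum_tmul_eq F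
  obtain ⟨q, g, g', hF'⟩ := TensorProduct.exists_sum_tmul_eq F'
  have hvu := drinfeld_inv F F' hinv₁ hinv₂ hcu₁ hcu₂ hcoc
  have hue : u = ∑ j, f j * HopfAlgebra.antipode k (f' j) := by
    rw [hu, hF]; simp
  have hve : LinearMap.mul' k H (TensorProduct.map (HopfAlgebra.antipode k) LinearMap.id F') =
      ∑ l, HopfAlgebra.antipode k (g l) * g' l := by
    rw [hF']; simp
  rw [← hu, hve] at hvu
  have : IsArtinianRing H := IsArtinianRing.of_finite k H
  have huv := mul_eq_one_symm hvu
  have huinv : Ring.inverse u = ∑ l, HopfAlgebra.antipode k (g l) * g' l :=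
    Ring.inverse_unit (⟨u, _, huv, hvu⟩ : Hˣ)
  have hX : (((1 : H) ⊗ₜ[k] Fseq k H F (p + 1) : TensorProduct k H (Tpow k H (p + 1))) *
      ((1 : H) ⊗ₜ[k] comulIter k H (p + 1) Λ : TensorProduct k H (Tpow k H (p + 1))) *
      (show TensorProduct k H (Tpow k H (p + 1)) from
        snocEquiv k H (p + 1)
          (Ring.inverse (Fseq k H F (p + 1)) ⊗ₜ[k] (1 : H)))) =
      ∑ l, ∑ j, ∑ i, g l ⊗ₜ[k] snocAlg k H p
        (comulIterF k H F F' p (f j * a i * g' l) ⊗ₜ[k] (f' j * b i)) := by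
    have h1 : (show TensorProduct k H (Tpow k H (p + 1)) from
        snocEquiv k H (p + 1)
          (Ring.inverse (Fseq k H F (p + 1)) ⊗ₜ[k] (1 : H))) =
        snocS k H p ((idD k H p F' * ((1 : H) ⊗ₜ[k] Finv k H F' p)) ⊗ₜ[k] (1 : H)) := by
      rw [ring_inverse_Fseq k H F F' hinv₁ hinv₂, ← snocAlg_apply]
      rfl
    rw [h1, snoc_Finv k H F' g g' hF', Algebra.TensorProduct.tmul_mul_tmul, one_mul,
      Finset.mul_sum]
    refine Finset.sum_congr rfl fun l _ => ?_
    rw [Algebra.TensorProduct.tmul_mul_tmul, one_mul,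
      inner_eq k H F F' hcoc f f' hF Λ a b hrep]
    simp only [TensorProduct.tmul_sum]
  have hM : ∀ (x : H) (y : Tpow k H p) (z : H),
      (LinearMap.mul' k H ∘ₗ TensorProduct.map LinearMap.id (LinearMap.mul' k H))
          ((TensorProduct.map LinearMap.id
              ((TensorProduct.map Y LinearMap.id) ∘ₗ (snocEquiv k H p).symm.toLinearMap) :
              TensorProduct k H (Tpow k H (p + 1)) →ₗ[k] TensorProduct k H (H ⊗[k] H))
            (x ⊗ₜ[k] snocAlg k H p (y ⊗ₜ[k] z))) = x * (Y y * z) := by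
    intro x y z
    rw [snocAlg_apply]
    simp
  rw [hX]
  simp only [map_sum, hM]
  have hcore := core_identity lam Λ hΛ hlam hnorm a b hrep f f' g g'
    (Y ∘ₗ comulIterF k H F F' p)
  simp only [LinearMap.comp_apply] at hcore
  rw [hcore, hSF, ← hue, ← huinv]
  rfl
end

section
/- Let H be a finite-dimensional Hopf algebra over a field k with antipode S, and let λ, Λ be normalized integrals (λ a right cointegral, Λ a left integral, λ(Λ) = 1). For coprime integers n > 1 and k coprime to n, define the shuffled Sweedler power P̃^{(n,k)}(x) = x₍k̄₎ x₍2k̄₎ ⋯ x₍(n−1)k̄₎ (indices are least positive residues mod n on the n-fold coproduct of x) and ν̃_{n,k}(H) = Tr(S ∘ P̃^{(n,k)}). Then ν̃_{n,k}(H) = λ(S(Λ₍k̄₎ Λ₍2k̄₎ ⋯ Λ₍(n−1)k̄₎ Λ₍ₙ₎)). -/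
/-!
STATEMENT 12:
For a finite-dimensional Hopf algebra H with antipode S and normalized integrals λ, Λ,
and coprime integers n > 1 and l, the shuffled Sweedler power
P̃^{(n,l)} = m ∘ σ_{(n,l)} ∘ Δ^{n-1}  (σ_{(n,l)}(i) = il mod n, least positive residues)
satisfies
  ν̃_{n,l}(H) := Tr(S ∘ P̃^{(n,l)}) = λ(S(Λ₍l̄₎ Λ₍2l̄₎ ⋯ Λ₍₍n₋₁₎l̄₎ Λ₍ₙ₎)),
where the indices on the right refer to the components of the n-fold comultiplication
of Λ (encoded by a finite-sum representation).
-/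

open TensorProduct

section
variable (k H : Type) [Field k] [Ring H] [HopfAlgebra k H]

/-- The nested pure tensor `f 0 ⊗ f 1 ⊗ ⋯ ⊗ f n` of a tuple. -/
noncomputable def nest : ∀ n : ℕ, (Fin (n + 1) → H) → Tpow k H n
  | 0, f => f 0
  | n + 1, f =>
      show TensorProduct k H (Tpow k H n) from f 0 ⊗ₜ[k] nest n (fun i => f i.succ)

end

open HopfAlgebra Coalgebra

theorem aux_S {k H : Type} [Field k] [Ring H] [HopfAlgebra k H] (h : H) :
    TensorProduct.map (LinearMap.mul' k H ∘ₗ (antipode k).rTensor H) LinearMap.id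
      ((TensorProduct.assoc k H H H).symm (comul.lTensor H (comul (R := k) h))) =
        1 ⊗ₜ[k] h := by
  rw [Coalgebra.coassoc_symm_apply]
  rw [← LinearMap.rTensor_def, ← LinearMap.comp_apply, ← LinearMap.rTensor_comp]
  rw [LinearMap.comp_assoc, HopfAlgebra.mul_antipode_rTensor_comul, LinearMap.rTensor_comp,
    LinearMap.comp_apply, Coalgebra.rTensor_counit_comul]
  simp

theorem aux_S2 {k H : Type} [Field k] [Ring H] [HopfAlgebra k H] (Λ : H)
    (hΛ : ∀ h : H, h * Λ = Coalgebra.counit (R := k) h • Λ) (h : H) :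
    (antipode k h ⊗ₜ[k] (1 : H)) * comul Λ = ((1 : H) ⊗ₜ[k] h) * comul Λ := by
  rw [← aux_S h]
  have key : ∀ w : H ⊗[k] H,
      TensorProduct.map (LinearMap.mul' k H ∘ₗ (antipode k).rTensor H) LinearMap.id
      ((TensorProduct.assoc k H H H).symm (comul.lTensor H w)) * comul Λ =
      (antipode k (TensorProduct.rid k H (counit.lTensor H w)) ⊗ₜ[k] (1 : H)) * comul Λ := by
    intro w
    induction w with
    | zero => simp
    | add x y hx hy => simp only [map_add, add_mul, hx, hy, TensorProduct.add_tmul]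
    | tmul x y =>
      have h1 : ∀ z : H ⊗[k] H,
        TensorProduct.map (LinearMap.mul' k H ∘ₗ (antipode k).rTensor H) LinearMap.id
          ((TensorProduct.assoc k H H H).symm (x ⊗ₜ z)) = (antipode k x ⊗ₜ[k] (1 : H)) * z := by
        intro z
        induction z with
        | zero => simp
        | add a b ha hb => simp only [TensorProduct.tmul_add, map_add, mul_add, ha, hb]
        | tmul a b => simp
      rw [LinearMap.lTensor_tmul, h1, mul_assoc, ← Bialgebra.comul_mul, hΛ]
      simp only [map_smul, mul_smul_comm, LinearMap.lTensor_tmul, TensorProduct.rid_tmul]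
      rw [← TensorProduct.smul_tmul', smul_mul_assoc]
  rw [key, Coalgebra.lTensor_counit_comul]
  simp

theorem aux_trace {k H : Type} [Field k] [Ring H] [HopfAlgebra k H] [FiniteDimensional k H]
    (lam : H →ₗ[k] k) (Λ : H)
    (hΛ : ∀ h : H, h * Λ = Coalgebra.counit (R := k) h • Λ)
    (hlam : ∀ h : H,
      (TensorProduct.lid k H) ((TensorProduct.map lam LinearMap.id)
        (Coalgebra.comul (R := k) h)) = lam h • (1 : H))
    (hnorm : lam Λ = 1) (X : H →ₗ[k] H) :
    LinearMap.trace k H X =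
      lam (LinearMap.mul' k H (TensorProduct.comm k H H
        (TensorProduct.map X (antipode k) (comul Λ)))) := by
  obtain ⟨R⟩ : Nonempty (Coalgebra.Repr k Λ (H × H)) := ⟨ℛ k Λ⟩
  -- first dual basis identity
  have e1 : ∀ h : H, ∑ i ∈ R.index, lam (antipode k h * R.left i) • R.right i = h := by
    intro h
    have e := congrArg (fun z => TensorProduct.lid k H (TensorProduct.map lam LinearMap.id z))
      (aux_S2 Λ hΛ h)
    have e2 := congrArg (fun z => h * z) (hlam Λ)
    rw [← R.eq] at e e2
    simp only [Finset.mul_sum, map_sum, Algebra.TensorProduct.tmul_mul_tmul, one_mul,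
      TensorProduct.map_tmul, LinearMap.id_apply, TensorProduct.lid_tmul, mul_smul_comm,
      hnorm, mul_one, one_smul] at e e2
    rw [e, e2]
  let φ : H →ₗ[k] Module.Dual k H := LinearMap.compr₂ (LinearMap.mul k H ∘ₗ antipode k) lam
  let ψ : Module.Dual k H →ₗ[k] H :=
    ∑ i ∈ R.index, LinearMap.smulRight (Module.Dual.eval k H (R.left i)) (R.right i)
  have h1 : ψ ∘ₗ φ = LinearMap.id := by
    ext h
    simpa [φ, ψ] using e1 h
  have h2 : φ ∘ₗ ψ = LinearMap.id := by
    have inj : Function.Injective φ := by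
      apply Function.LeftInverse.injective (g := ψ)
      intro x; exact LinearMap.congr_fun h1 x
    have surj : Function.Surjective φ :=
      (LinearMap.injective_iff_surjective_of_finrank_eq_finrank
        (Subspace.dual_finrank_eq (K := k) (V := H)).symm).1 inj
    ext f y
    obtain ⟨x, rfl⟩ := surj f
    have := LinearMap.congr_fun h1 x
    simp only [LinearMap.comp_apply, LinearMap.id_apply] at this ⊢
    rw [this]
  have e3 : ∀ h : H, ∑ i ∈ R.index, lam (antipode k (R.right i) * h) • R.left i = h := by
    intro h
    rw [← sub_eq_zero, ← Module.forall_dual_apply_eq_zero_iff k]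
    intro f
    rw [map_sub, sub_eq_zero]
    have := LinearMap.congr_fun (LinearMap.congr_fun h2 f) h
    simpa [φ, ψ, mul_comm] using this
  have hX : X = ∑ i ∈ R.index, LinearMap.smulRight (φ (R.right i)) (X (R.left i)) := by
    ext h
    conv_lhs => rw [← e3 h]
    simp [φ]
  rw [← R.eq]
  conv_lhs => rw [hX]
  simp [φ]

section
variable (k H : Type) [Field k] [Ring H] [HopfAlgebra k H]

noncomputable def tlift : ∀ n : ℕ,
    MultilinearMap k (fun _ : Fin (n + 1) => H) H →ₗ[k] (Tpow k H n →ₗ[k] H)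
  | 0 => show MultilinearMap k (fun _ : Fin 1 => H) H →ₗ[k] (H →ₗ[k] H) from
      (MultilinearMap.ofSubsingletonₗ k k H H (0 : Fin 1)).symm.toLinearMap
  | n + 1 => show MultilinearMap k (fun _ : Fin (n + 2) => H) H →ₗ[k]
        (H ⊗[k] Tpow k H n →ₗ[k] H) from
      TensorProduct.uncurry (RingHom.id k) H (Tpow k H n) H ∘ₗ LinearMap.compRight k (tlift n) ∘ₗ
        (multilinearCurryLeftEquiv k (fun _ : Fin (n + 2) => H) H).toLinearMap

theorem tlift_nest : ∀ (n : ℕ) (g : MultilinearMap k (fun _ : Fin (n + 1) => H) H)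
    (f : Fin (n + 1) → H), tlift k H n g (nest k H n f) = g f
  | 0, g, f => by
    change g (fun _ => f 0) = g f
    congr 1
    ext i
    exact congrArg f (Fin.ext (by omega))
  | n + 1, g, f => by
    change tlift k H n (g.curryLeft (f 0)) (nest k H n (fun i => f i.succ)) = g f
    rw [tlift_nest n]
    exact congrArg g (Fin.cons_self_tail f)

theorem exists_rep : ∀ (n : ℕ) (x : Tpow k H n),
    ∃ (m : ℕ) (L : Fin m → Fin (n + 1) → H), x = ∑ i, nest k H n (L i)
  | 0, x => ⟨1, fun _ _ => x, by simp [nest]⟩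
  | n + 1, x => by
    change H ⊗[k] Tpow k H n at x
    induction x with
    | zero => exact ⟨0, fun i => i.elim0, by simp; rfl⟩
    | add x y hx hy =>
      obtain ⟨m, L, h⟩ := hx
      obtain ⟨m', L', h'⟩ := hy
      refine ⟨m + m', Fin.append L L', ?_⟩
      rw [Fin.sum_univ_add]
      simp only [Fin.append_left, Fin.append_right, ← h, ← h']
      rfl
    | tmul a y =>
      obtain ⟨m, L, h⟩ := exists_rep n y
      refine ⟨m, fun i => Fin.cons a (L i), ?_⟩
      rw [h, TensorProduct.tmul_sum]
      simp only [nest, Fin.cons_zero, Fin.cons_succ]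
      rfl

noncomputable def tsnoc : ∀ n : ℕ, Tpow k H n ⊗[k] H →ₗ[k] Tpow k H (n + 1)
  | 0 => show H ⊗[k] H →ₗ[k] H ⊗[k] H from LinearMap.id
  | n + 1 => show (H ⊗[k] Tpow k H n) ⊗[k] H →ₗ[k] H ⊗[k] Tpow k H (n + 1) from
      (tsnoc n).lTensor H ∘ₗ (TensorProduct.assoc k H (Tpow k H n) H).toLinearMap

theorem tsnoc_nest : ∀ (n : ℕ) (f : Fin (n + 1) → H) (h : H),
    tsnoc k H n (nest k H n f ⊗ₜ h) = nest k H (n + 1) (Fin.snoc (α := fun _ => H) f h)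
  | 0, f, h => rfl
  | n + 1, f, h => by
    have := tsnoc_nest n (fun i => f i.succ) h
    change f 0 ⊗ₜ[k] (tsnoc k H n (nest k H n (fun i => f i.succ) ⊗ₜ h)) = 
      (Fin.snoc (α := fun _ => H) f h : Fin (n + 1 + 1 + 1) → H) 0 ⊗ₜ[k] 
        nest k H (n + 1) (fun i => (Fin.snoc (α := fun _ => H) f h : Fin (n + 1 + 1 + 1) → H) i.succ)
    rw [this]
    congr 2
    ext i
    refine Fin.lastCases ?_ (fun j => ?_) i
    · rw [Fin.snoc_last, Fin.succ_last, Fin.snoc_last]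
    · rw [Fin.snoc_castSucc, Fin.succ_castSucc, Fin.snoc_castSucc]

theorem comulIter_snoc : ∀ (n : ℕ) (x : H),
    comulIter k H (n + 1) x =
      tsnoc k H n ((comulIter k H n).rTensor H (Coalgebra.comul (R := k) x))
  | 0, x => rfl
  | n + 1, x => by
    have ih := comulIter_snoc n
    have ih' : comulIter k H (n + 1) = 
      tsnoc k H n ∘ₗ (comulIter k H n).rTensor H ∘ₗ Coalgebra.comul (R := k) := 
      LinearMap.ext ih
    change (comulIter k H (n+1)).lTensor H (Coalgebra.comul (R := k) x) = 
      (tsnoc k H n).lTensor H (TensorProduct.assoc k H (Tpow k H n) H 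
       (((comulIter k H n).lTensor H ∘ₗ Coalgebra.comul (R := k)).rTensor H (Coalgebra.comul (R := k) x)))
    rw [ih', LinearMap.lTensor_comp, LinearMap.lTensor_comp, LinearMap.rTensor_comp]
    simp only [LinearMap.comp_apply]
    rw [← Coalgebra.coassoc_apply]
    congr 1
    generalize (Coalgebra.comul.rTensor H) (Coalgebra.comul (R := k) x) = w
    induction w with
    | zero => simp
    | add x y hx hy => simp only [map_add, hx, hy]
    | tmul x y => 
      induction x with
      | zero => simp
      | add x y hx hy => simp only [map_add, TensorProduct.add_tmul, hx, hy]
      | tmul x y => simp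

/-- The shuffled multiplication `H^{⊗(n+1)} → H`. -/
noncomputable def shufMul (n : ℕ) (σ : Equiv.Perm (Fin (n + 1))) : Tpow k H n →ₗ[k] H :=
  tlift k H n ((MultilinearMap.mkPiAlgebraFin k (n + 1) H).domDomCongr σ)

theorem shufMul_nest (n : ℕ) (σ : Equiv.Perm (Fin (n + 1))) (f : Fin (n + 1) → H) :
    shufMul k H n σ (nest k H n f) = (List.ofFn (fun t => f (σ t))).prod := by
  rw [shufMul, tlift_nest]
  simp

theorem shufMul_snoc (n : ℕ) (σ : Equiv.Perm (Fin (n + 1))) (σ' : Equiv.Perm (Fin (n + 2)))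
    (h1 : ∀ t : Fin (n + 1), σ' t.castSucc = (σ t).castSucc)
    (h2 : σ' (Fin.last (n + 1)) = Fin.last (n + 1)) (x : Tpow k H n) (h : H) :
    shufMul k H (n + 1) σ' (tsnoc k H n (x ⊗ₜ h)) = shufMul k H n σ x * h := by
  obtain ⟨m, L, rfl⟩ := exists_rep k H n x
  rw [TensorProduct.sum_tmul, map_sum, map_sum, map_sum, Finset.sum_mul]
  refine Finset.sum_congr rfl fun i _ => ?_
  rw [tsnoc_nest, shufMul_nest, shufMul_nest, List.ofFn_succ']
  simp [h1, h2, mul_assoc]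

theorem main_aux [FiniteDimensional k H]
    (lam : H →ₗ[k] k) (Λ : H)
    (hΛ : ∀ h : H, h * Λ = Coalgebra.counit (R := k) h • Λ)
    (hlam : ∀ h : H,
      (TensorProduct.lid k H) ((TensorProduct.map lam LinearMap.id)
        (Coalgebra.comul (R := k) h)) = lam h • (1 : H))
    (hnorm : lam Λ = 1)
    (N l : ℕ)
    (σ : Equiv.Perm (Fin (N + 1)))
    (hσ : ∀ t : Fin (N + 1), (σ t : ℕ) = (((t : ℕ) + 1) * l + (N + 2) - 1) % (N + 2))
    (P : H →ₗ[k] H)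
    (hP : ∀ (x : H) (m : ℕ) (L : Fin m → Fin (N + 1) → H),
      comulIter k H N x = ∑ i, nest k H N (L i) →
      P x = ∑ i, (List.ofFn (fun t : Fin (N + 1) => L i (σ t))).prod)
    (σ' : Equiv.Perm (Fin (N + 1 + 1)))
    (hσ' : ∀ t : Fin (N + 1 + 1), (σ' t : ℕ) = (((t : ℕ) + 1) * l + (N + 2) - 1) % (N + 2))
    (m' : ℕ) (L' : Fin m' → Fin (N + 1 + 1) → H)
    (hrep : comulIter k H (N + 1) Λ = ∑ i, nest k H (N + 1) (L' i)) :
    LinearMap.trace k H (antipode k ∘ₗ P) =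
      ∑ i, lam (antipode k ((List.ofFn (fun t : Fin (N + 1 + 1) => L' i (σ' t))).prod)) := by
  have h1 : ∀ t : Fin (N + 1), σ' t.castSucc = (σ t).castSucc := by
    intro t
    ext
    rw [hσ', Fin.val_castSucc, Fin.val_castSucc, hσ]
  have h2 : σ' (Fin.last (N + 1)) = Fin.last (N + 1) := by
    ext
    rw [hσ', Fin.val_last]
    have : (N + 1 + 1) * l + (N + 2) - 1 = (N + 1) + (N + 2) * l := by
      have : (N + 1 + 1) * l = (N + 2) * l := rfl
      omega
    rw [this, Nat.add_mul_mod_self_left, Nat.mod_eq_of_lt (by omega)]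
  have hPM : ∀ x, P x = shufMul k H N σ (comulIter k H N x) := by
    intro x
    obtain ⟨m, L, h⟩ := exists_rep k H N (comulIter k H N x)
    rw [hP x m L h, h, map_sum]
    simp only [shufMul_nest]
  have hR : ∑ i, lam (antipode k ((List.ofFn (fun t : Fin (N + 1 + 1) => L' i (σ' t))).prod)) =
      lam (antipode k (shufMul k H (N + 1) σ' (comulIter k H (N + 1) Λ))) := by
    rw [hrep]
    simp only [map_sum, shufMul_nest]
  rw [hR, comulIter_snoc, aux_trace lam Λ hΛ hlam hnorm]
  congr 1
  generalize Coalgebra.comul (R := k) Λ = w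
  induction w with
  | zero => simp
  | add x y hx hy => simp only [map_add, hx, hy]
  | tmul x y =>
    rw [LinearMap.rTensor_tmul, shufMul_snoc k H N σ σ' h1 h2, ← hPM,
      HopfAlgebra.antipode_mul_antidistrib]
    simp

end

theorem statement12
    (k H : Type) [Field k] [Ring H] [HopfAlgebra k H] [FiniteDimensional k H]
    (S : H →ₗ[k] H) (hS : S = HopfAlgebra.antipode (R := k))
    (lam : H →ₗ[k] k) (Λ : H)
    (hΛ : ∀ h : H, h * Λ = Coalgebra.counit (R := k) h • Λ)
    (hlam : ∀ h : H,
      (TensorProduct.lid k H) ((TensorProduct.map lam LinearMap.id)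
        (Coalgebra.comul (R := k) h)) = lam h • (1 : H))
    (hnorm : lam Λ = 1)
    (n l : ℕ) (hn : 1 < n) (hcop : Nat.Coprime n l)
    -- the permutation σ_{(n,l)} ∈ Sym_{n-1} (0-based on Fin (n-1) = Fin (n-2+1)) :
    (σ : Equiv.Perm (Fin (n - 2 + 1)))
    (hσ : ∀ t : Fin (n - 2 + 1), (σ t : ℕ) = (((t : ℕ) + 1) * l + n - 1) % n)
    -- P̃^{(n,l)} = m ∘ σ_{(n,l)} ∘ Δ^{n-1} :
    (P : H →ₗ[k] H)
    (hP : ∀ (x : H) (m : ℕ) (L : Fin m → Fin (n - 2 + 1) → H),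
      comulIter k H (n - 2) x = ∑ i, nest k H (n - 2) (L i) →
      P x = ∑ i, (List.ofFn (fun t : Fin (n - 2 + 1) => L i (σ t))).prod)
    -- the extension of σ_{(n,l)} to Sym_n fixing the last letter
    -- (0-based on Fin n = Fin (n-1+1)) :
    (σ' : Equiv.Perm (Fin (n - 1 + 1)))
    (hσ' : ∀ t : Fin (n - 1 + 1), (σ' t : ℕ) = (((t : ℕ) + 1) * l + n - 1) % n)
    -- a finite-sum representation of the n-fold comultiplication Δⁿ(Λ) :
    (m' : ℕ) (L' : Fin m' → Fin (n - 1 + 1) → H)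
    (hrep : comulIter k H (n - 1) Λ = ∑ i, nest k H (n - 1) (L' i)) :
    LinearMap.trace k H (S ∘ₗ P) =
      ∑ i, lam (S ((List.ofFn (fun t : Fin (n - 1 + 1) => L' i (σ' t))).prod)) := by
  obtain ⟨N, rfl⟩ : ∃ N, n = N + 2 := ⟨n - 2, by omega⟩
  subst hS
  exact main_aux k H lam Λ hΛ hlam hnorm N l σ hσ P hP σ' hσ' m' L' hrep
end

section
/- Let H be a finite-dimensional Hopf algebra with antipode S and normalized integrals λ, Λ. Let n > k > 0 be coprime with n − k odd, and let (c_i) be the sequence of Definition with c_n = 0 and the three-case recursion. Define P^{(n,−k)} = m ∘ σ_{(n,−k)} ∘ (⨂_{i=1}^{n−1} S^{2c_i}) ∘ Δ^{n−1} : H → H, where σ_{(n,−k)}(i) = −ik mod n. Then λ(S^{s_n}(Λ₍ₙ₎) S^{s_k}(Λ₍k₎) ⋯ S^{s_{n−k}}(Λ₍n−k₎)) = Tr(S ∘ P^{(n,−k)}), where s_i = 2c_i + 1 and the product is taken over the cyclic order n, k̄, 2k̄, …, (n−1)k̄ = n − k of the coproduct indices. -/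
/-!
STATEMENT 15 (Theorem `t:KInd`):
For a finite-dimensional Hopf algebra H with antipode S (with inverse S⁻¹) and
normalized integrals λ, Λ, and coprime n > K > 0 with n − K odd, let (c_i) be the
integer sequence of Definition `d:cp` and s_i = 2c_i + 1.  Then
  λ(S^{s_n}(Λ₍ₙ₎) S^{s_K}(Λ₍K₎) S^{s_{2K}}(Λ₍₂K₎) ⋯ S^{s_{n−K}}(Λ₍n−K₎)) = Tr(S ∘ P^{(n,−K)}),
where P^{(n,−K)} = m ∘ σ_{(n,−K)} ∘ (⨂_{i=1}^{n−1} S^{2c_i}) ∘ Δ^{n−1}, the indices on the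
left running through the cyclic order n, K̄, 2K̄, …, (n−1)K̄ = n − K of the components of
Δⁿ(Λ) (encoded by a finite-sum representation).  This common value is the Kuperberg
invariant K(L(n,K), 𝔣_R, H).
-/

open TensorProduct

section
variable (k H : Type) [Field k] [Ring H] [HopfAlgebra k H]

/-- Integer powers of the antipode, `Spow S Sinv z = S^z`. -/
noncomputable def Spow (S Sinv : H →ₗ[k] H) (z : ℤ) : H →ₗ[k] H :=
  if 0 ≤ z then S ^ z.toNat else Sinv ^ (-z).toNat

end

/-- least positive residue of `a` modulo `n` (valued in {1, …, n} for n ≥ 1). -/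
def lpr (a n : ℕ) : ℕ := (a + n - 1) % n + 1

/-- the three-case recursion of Definition `d:cp` for the pair (n, K), with
`k₀ = (n − K − 1)/2`, and initial condition `c n = 0`. -/
def IsCSeq (n K : ℕ) (c : ℕ → ℤ) : Prop :=
  c n = 0 ∧
  (∀ i : ℕ, 1 ≤ i → i ≤ (n - K - 1) / 2 → c (i + K) = c i + 1) ∧
  (∀ i : ℕ, (n - K - 1) / 2 + 1 ≤ i → i ≤ 2 * ((n - K - 1) / 2) → c (i + K) = c i - 1) ∧
  (∀ i : ℕ, 2 * ((n - K - 1) / 2) + 1 ≤ i → i ≤ n → c (lpr (i + K) n) = c i)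

open Coalgebra WithConv in
theorem aux_shift (k H : Type) [Field k] [Ring H] [HopfAlgebra k H] (h : H) :
    ∑ i ∈ (ℛ k h).index, ((HopfAlgebra.antipode k ((ℛ k h).left i)) ⊗ₜ[k] (1:H)) *
      comul (R := k) ((ℛ k h).right i) = (1:H) ⊗ₜ[k] h := by
  let i1 : H →ₐ[k] H ⊗[k] H := Algebra.TensorProduct.includeLeft
  let i2 : H →ₐ[k] H ⊗[k] H := Algebra.TensorProduct.includeRight
  let S : H →ₗ[k] H := HopfAlgebra.antipode k
  have e1 : toConv (comul (R := k) (A := H)) =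
      toConv i1.toLinearMap * toConv i2.toLinearMap := by
    ext x
    rw [(ℛ k x).convMul_apply]
    simp only [i1, i2]
    refine (ℛ k x).eq.symm.trans ?_
    simp
  have e2 : toConv (i1.toLinearMap ∘ₗ S) * toConv i1.toLinearMap = 1 := by
    have := LinearMap.algHom_comp_convMul_distrib i1 (toConv S)
      (toConv (LinearMap.id (R := k) (M := H)))
    rw [LinearMap.antipode_mul_id] at this
    apply WithConv.ext
    refine Eq.trans this.symm ?_
    ext x
    simp [i1]
  have e3 : toConv (i1.toLinearMap ∘ₗ S) * toConv (comul (R := k) (A := H)) =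
      toConv i2.toLinearMap := by
    rw [e1, ← mul_assoc, e2, one_mul]
  have e4 := congrArg (fun f => f.ofConv h) e3
  simp only [(ℛ k h).convMul_apply] at e4
  exact e4

open Coalgebra WithConv in
theorem aux_comul_antipode (k H : Type) [Field k] [Ring H] [HopfAlgebra k H] (x : H) :
    comul (R := k) (HopfAlgebra.antipode k x) =
      TensorProduct.map (HopfAlgebra.antipode k) (HopfAlgebra.antipode k)
        (TensorProduct.comm k H H (comul (R := k) x)) := by
  let i1 : H →ₐ[k] H ⊗[k] H := Algebra.TensorProduct.includeLeft
  let i2 : H →ₐ[k] H ⊗[k] H := Algebra.TensorProduct.includeRight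
  let S : H →ₗ[k] H := HopfAlgebra.antipode k
  have e1 : toConv (comul (R := k) (A := H)) =
      toConv i1.toLinearMap * toConv i2.toLinearMap := by
    ext x
    rw [(ℛ k x).convMul_apply]
    simp only [i1, i2]
    refine (ℛ k x).eq.symm.trans ?_
    simp
  have e2 : ∀ i : H →ₐ[k] H ⊗[k] H,
      toConv (i.toLinearMap ∘ₗ S) * toConv i.toLinearMap = 1 := by
    intro i
    have := LinearMap.algHom_comp_convMul_distrib i (toConv S)
      (toConv (LinearMap.id (R := k) (M := H)))
    rw [LinearMap.antipode_mul_id] at this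
    apply WithConv.ext
    refine Eq.trans this.symm ?_
    ext x
    simp
  have e3 : (toConv (i2.toLinearMap ∘ₗ S) * toConv (i1.toLinearMap ∘ₗ S)) *
      toConv (comul (R := k) (A := H)) = 1 := by
    rw [e1, mul_assoc, ← mul_assoc (toConv (i1.toLinearMap ∘ₗ S)), e2, one_mul, e2]
  have e4 := left_inv_eq_right_inv e3 (LinearMap.comul_right_inv (R := k) (C := H))
  have e5 := congrArg (fun f => f.ofConv x) e4
  simp only [(ℛ k x).convMul_apply] at e5
  refine Eq.trans e5.symm ?_
  rw [← (ℛ k x).eq]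
  simp [i1, i2, S]

open Coalgebra in
theorem aux_int (k H : Type) [Field k] [Ring H] [HopfAlgebra k H] (Λ : H)
    (hΛ : ∀ h : H, h * Λ = counit (R := k) h • Λ) (h : H) :
    ((1:H) ⊗ₜ[k] h) * comul (R := k) Λ =
      (HopfAlgebra.antipode k h ⊗ₜ[k] (1:H)) * comul (R := k) Λ := by
  have key : ∑ i ∈ (ℛ k h).index, counit (R := k) ((ℛ k h).right i) • (ℛ k h).left i = h := by
    have := congrArg (TensorProduct.rid k H) (sum_tmul_counit_eq (ℛ k h))
    simp only [map_sum, TensorProduct.rid_tmul, one_smul] at this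
    exact this
  rw [← aux_shift k H h, Finset.sum_mul]
  have : ∀ i ∈ (ℛ k h).index, ((HopfAlgebra.antipode k ((ℛ k h).left i)) ⊗ₜ[k] (1:H)) *
      comul (R := k) ((ℛ k h).right i) * comul (R := k) Λ =
      ((HopfAlgebra.antipode k (counit (R := k) ((ℛ k h).right i) • (ℛ k h).left i)) ⊗ₜ[k] (1:H))
        * comul (R := k) Λ := by
    intro i _
    rw [mul_assoc, ← Bialgebra.comul_mul, hΛ, map_smul, map_smul, mul_smul_comm,
      ← TensorProduct.smul_tmul', smul_mul_assoc]
  rw [Finset.sum_congr rfl this, ← Finset.sum_mul, ← TensorProduct.sum_tmul, ← map_sum, key]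

open Coalgebra in
/-- Radford's trace formula. -/
theorem aux_radford (k H : Type) [Field k] [Ring H] [HopfAlgebra k H] [FiniteDimensional k H]
    (S Sinv : H →ₗ[k] H) (hS : S = HopfAlgebra.antipode (R := k))
    (hSinv₁ : ∀ h : H, Sinv (S h) = h) (hSinv₂ : ∀ h : H, S (Sinv h) = h)
    (lam : H →ₗ[k] k) (Λ : H)
    (hΛ : ∀ h : H, h * Λ = counit (R := k) h • Λ)
    (hlam : ∀ h : H,
      (TensorProduct.lid k H) ((TensorProduct.map lam LinearMap.id)
        (comul (R := k) h)) = lam h • (1 : H))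
    (hnorm : lam Λ = 1) (X : H →ₗ[k] H) :
    LinearMap.trace k H X = ∑ i ∈ (ℛ k Λ).index, lam (S ((ℛ k Λ).right i) * X ((ℛ k Λ).left i)) := by
  have Smul : ∀ a b : H, S (a * b) = S b * S a := by
    intro a b; rw [hS]; exact HopfAlgebra.antipode_mul_antidistrib a b
  have hΔ := (ℛ k Λ).eq
  set I := (ℛ k Λ).index
  set a := (ℛ k Λ).left
  set b := (ℛ k Λ).right
  have h1 : ∀ h : H, ∑ i ∈ I, (h * a i) ⊗ₜ[k] S (b i) = ∑ i ∈ I, a i ⊗ₜ[k] (S (b i) * h) := by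
    intro h
    have := aux_int k H Λ hΛ (Sinv h)
    rw [← hΔ, ← hS, hSinv₂, Finset.mul_sum, Finset.mul_sum] at this
    have := congrArg (TensorProduct.map LinearMap.id S) this
    simp only [Algebra.TensorProduct.tmul_mul_tmul, one_mul, map_sum, TensorProduct.map_tmul,
      LinearMap.id_apply, Smul, hSinv₂] at this
    exact this.symm
  -- λ(Λ₁) Λ₂ = 1
  have l1 : ∑ i ∈ I, lam (a i) • b i = 1 := by
    have := hlam Λ
    rw [← hΔ, hnorm] at this
    simpa using this
  have hS1 : S 1 = 1 := by rw [hS]; exact HopfAlgebra.antipode_one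
  have l2 : ∑ i ∈ I, lam (S (b i)) • a i = lam (S Λ) • (1 : H) := by
    have := hlam (S Λ)
    rw [hS, aux_comul_antipode, ← hΔ, ← hS] at this
    simp only [map_sum, TensorProduct.map_tmul, LinearMap.id_apply, TensorProduct.lid_tmul,
      TensorProduct.comm_tmul] at this
    have := congrArg Sinv this
    simp only [map_sum, map_smul, hSinv₁] at this
    rw [this]
    congr 1
    have h11 := hSinv₁ 1
    rwa [hS1] at h11
  have hA : ∀ h : H, ∑ i ∈ I, lam (h * a i) • S (b i) = h := by
    intro h
    have := congrArg (fun z => TensorProduct.lid k H (TensorProduct.map lam LinearMap.id z)) (h1 h)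
    simp only [map_sum, TensorProduct.map_tmul, LinearMap.id_apply, TensorProduct.lid_tmul] at this
    rw [this]
    have l1' := congrArg S l1
    rw [map_sum, hS1] at l1'
    simp only [map_smul] at l1'
    simp only [← smul_mul_assoc]
    rw [← Finset.sum_mul, l1', one_mul]
  have hn : lam (S Λ) = 1 := by
    have h2 := congrArg lam (hA Λ)
    have h3 := congrArg (fun z => lam (Λ * z)) l2
    simp only [Finset.mul_sum, map_sum, mul_smul_comm, map_smul, smul_eq_mul, mul_one, hnorm] at h2 h3
    rw [← h3, ← h2]
    exact Finset.sum_congr rfl fun i _ => mul_comm _ _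
  have hB : ∀ h : H, ∑ i ∈ I, lam (S (b i) * h) • a i = h := by
    intro h
    have := congrArg (fun z => TensorProduct.rid k H (TensorProduct.map LinearMap.id lam z)) (h1 h)
    simp only [map_sum, TensorProduct.map_tmul, LinearMap.id_apply, TensorProduct.rid_tmul] at this
    rw [← this]
    simp only [← mul_smul_comm]
    rw [← Finset.mul_sum, l2, hn, one_smul, mul_one]
  have hX : X = ∑ i ∈ I, (lam ∘ₗ LinearMap.mulLeft k (S (b i))).smulRight (X (a i)) := by
    ext h
    conv_lhs => rw [← hB h]
    simp [map_sum]
  conv_lhs => rw [hX]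
  simp [map_sum, LinearMap.trace_smulRight]


theorem aux_lift (k H V : Type) [Field k] [Ring H] [HopfAlgebra k H] [AddCommGroup V] [Module k V]
    (n : ℕ) : ∃ T : MultilinearMap k (fun _ : Fin (n + 1) => H) V →ₗ[k] (Tpow k H n →ₗ[k] V),
      ∀ M f, T M (nest k H n f) = M f := by
  induction n with
  | zero =>
    refine ⟨((MultilinearMap.ofSubsingletonₗ k k H V (0 : Fin 1)).symm.toLinearMap :
      MultilinearMap k (fun _ : Fin (0 + 1) => H) V →ₗ[k] (H →ₗ[k] V)), ?_⟩
    intro M f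
    change M (fun _ => f 0) = M f
    congr 1
    ext i
    rw [show i = 0 from Fin.fin_one_eq_zero i]
  | succ n ih =>
    obtain ⟨T, hT⟩ := ih
    let T' : MultilinearMap k (fun _ : Fin (n + 1 + 1) => H) V →ₗ[k]
        (TensorProduct k H (Tpow k H n) →ₗ[k] V) :=
      { toFun := fun M => TensorProduct.lift (T ∘ₗ M.curryLeft)
        map_add' := by
          intro M N
          apply TensorProduct.ext'
          intro x y
          simp only [TensorProduct.lift.tmul, LinearMap.add_apply, LinearMap.comp_apply]
          rw [← LinearMap.add_apply, ← map_add]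
          rfl
        map_smul' := by
          intro c M
          apply TensorProduct.ext'
          intro x y
          simp only [TensorProduct.lift.tmul, LinearMap.smul_apply, LinearMap.comp_apply,
            RingHom.id_apply]
          rw [← LinearMap.smul_apply, ← map_smul]
          rfl }
    refine ⟨T', ?_⟩
    intro M f
    change TensorProduct.lift (T ∘ₗ M.curryLeft)
      (f 0 ⊗ₜ[k] nest k H n (fun i => f i.succ)) = M f
    rw [TensorProduct.lift.tmul, LinearMap.comp_apply, hT, MultilinearMap.curryLeft_apply]
    congr 1
    exact Fin.cons_self_tail f

/-- every tensor is a finite sum of pure nested tensors -/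
theorem aux_span (k H : Type) [Field k] [Ring H] [HopfAlgebra k H]
    (n : ℕ) (x : Tpow k H n) : ∃ (m : ℕ) (L : Fin m → Fin (n + 1) → H),
      x = ∑ i, nest k H n (L i) := by
  induction n with
  | zero => exact ⟨1, fun _ _ => x, by simp [nest]⟩
  | succ n ih =>
    change TensorProduct k H (Tpow k H n) at x
    induction x using TensorProduct.induction_on with
    | zero => exact ⟨0, fun i => i.elim0, by rw [Fin.sum_univ_zero]; rfl⟩
    | tmul h y =>
      obtain ⟨m, L, rfl⟩ := ih y
      refine ⟨m, fun i => Fin.cons h (L i), ?_⟩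
      rw [TensorProduct.tmul_sum]
      rfl
    | add x y hx hy =>
      obtain ⟨m, L, rfl⟩ := hx
      obtain ⟨m', L', rfl⟩ := hy
      refine ⟨m + m', Fin.append L L', ?_⟩
      rw [Fin.sum_univ_add]
      simp only [Fin.append_left, Fin.append_right]
      rfl

/-- append a factor on the right -/
theorem aux_app (k H : Type) [Field k] [Ring H] [HopfAlgebra k H] (n : ℕ) :
    ∃ A : Tpow k H n ⊗[k] H →ₗ[k] Tpow k H (n + 1),
      (∀ f h, A (nest k H n f ⊗ₜ[k] h) = nest k H (n + 1) (Fin.snoc f h)) ∧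
      (∀ x, comulIter k H (n + 1) x =
        A (TensorProduct.map (comulIter k H n) LinearMap.id (Coalgebra.comul (R := k) x))) := by
  induction n with
  | zero =>
    refine ⟨(LinearMap.id : H ⊗[k] H →ₗ[k] H ⊗[k] H), ?_, ?_⟩
    · intro f h
      rfl
    · intro x
      rfl
  | succ n ih =>
    obtain ⟨A, hA1, hA2⟩ := ih
    refine ⟨(show (H ⊗[k] Tpow k H n) ⊗[k] H →ₗ[k] H ⊗[k] Tpow k H (n + 1) from
      TensorProduct.map LinearMap.id A ∘ₗ (TensorProduct.assoc k H (Tpow k H n) H).toLinearMap),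
      ?_, ?_⟩
    · intro f h
      change f 0 ⊗ₜ[k] A (nest k H n (fun i => f i.succ) ⊗ₜ[k] h) = _
      rw [hA1]
      change _ = (Fin.snoc f h : Fin (n + 3) → H) 0 ⊗ₜ[k]
        nest k H (n + 1) (fun i => (Fin.snoc f h : Fin (n + 3) → H) i.succ)
      have e0 : (Fin.snoc f h : Fin (n + 3) → H) 0 = f 0 := by
        exact Fin.snoc_castSucc (α := fun _ => H) h f 0
      have e1 : (fun i => (Fin.snoc f h : Fin (n + 3) → H) i.succ) =
          (Fin.snoc (fun i => f i.succ) h : Fin (n + 2) → H) := by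
        ext i
        refine Fin.lastCases ?_ (fun j => ?_) i
        · rw [Fin.succ_last, Fin.snoc_last, Fin.snoc_last]
        · rw [Fin.succ_castSucc, Fin.snoc_castSucc, Fin.snoc_castSucc]
      rw [e0, e1]
    · intro x
      change TensorProduct.map LinearMap.id (comulIter k H (n + 1)) (Coalgebra.comul (R := k) x) =
        TensorProduct.map LinearMap.id A (TensorProduct.assoc k H (Tpow k H n) H
          (TensorProduct.map (TensorProduct.map LinearMap.id (comulIter k H n) ∘ₗ
            Coalgebra.comul) LinearMap.id (Coalgebra.comul (R := k) x)))
      have e : comulIter k H (n + 1) =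
          A ∘ₗ TensorProduct.map (comulIter k H n) LinearMap.id ∘ₗ Coalgebra.comul :=
        LinearMap.ext hA2
      have h1 : TensorProduct.map LinearMap.id (comulIter k H (n + 1)) =
          TensorProduct.map LinearMap.id A ∘ₗ
          TensorProduct.map LinearMap.id (TensorProduct.map (comulIter k H n) LinearMap.id) ∘ₗ
          Coalgebra.comul.lTensor H := by
        apply TensorProduct.ext'
        intro y z
        simp only [e, TensorProduct.map_tmul, LinearMap.comp_apply, LinearMap.lTensor_tmul,
          LinearMap.id_apply]
      rw [h1]
      simp only [LinearMap.comp_apply]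
      rw [← Coalgebra.coassoc_apply]
      congr 1
      generalize Coalgebra.comul (R := k) x = w
      induction w using TensorProduct.induction_on with
      | zero => simp
      | add a b ha hb => simp only [map_add, ha, hb]
      | tmul a b =>
        simp only [LinearMap.rTensor_tmul, TensorProduct.map_tmul, LinearMap.comp_apply,
          LinearMap.id_apply]
        generalize Coalgebra.comul (R := k) a = w
        induction w using TensorProduct.induction_on with
        | zero => simp
        | add a b ha hb => simp only [map_add, TensorProduct.add_tmul, ha, hb]
        | tmul a c => simp

theorem aux_Spow (k H : Type) [Field k] [Ring H] [HopfAlgebra k H]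
    (S Sinv : H →ₗ[k] H) (hSinv₂ : ∀ h : H, S (Sinv h) = h) (z : ℤ) (x : H) :
    Spow k H S Sinv (2 * z + 1) x = S (Spow k H S Sinv (2 * z) x) := by
  unfold Spow
  by_cases hz : 0 ≤ z
  · rw [if_pos (by omega), if_pos (by omega)]
    rw [show (2 * z + 1).toNat = (2 * z).toNat + 1 by omega, pow_succ']
    rfl
  · rw [if_neg (by omega), if_neg (by omega)]
    rw [show (-(2 * z)).toNat = (-(2 * z + 1)).toNat + 1 by omega, pow_succ']
    exact (hSinv₂ _).symm

theorem aux_anti (k H : Type) [Field k] [Ring H] [HopfAlgebra k H]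
    (S : H →ₗ[k] H) (hS : S = HopfAlgebra.antipode (R := k)) (n : ℕ) (g : Fin n → H) :
    S (List.ofFn g).prod = (List.ofFn (fun t => S (g t.rev))).prod := by
  induction n with
  | zero => simp [hS]
  | succ n ih =>
    rw [List.ofFn_succ, List.prod_cons]
    rw [hS, HopfAlgebra.antipode_mul_antidistrib, ← hS, ih]
    rw [List.ofFn_succ', List.concat_eq_append, List.prod_append]
    simp [Fin.rev_castSucc]

theorem aux_mod (N K s t : ℕ) (hs : s ≤ N) (ht : t ≤ N)
    (h : (s + 1 + (N - t + 1) * K) % (N + 2) = 0) :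
    ((t + 1) * K + (N + 2) - 1) % (N + 2) = s := by
  obtain ⟨q, hq⟩ := Nat.dvd_of_mod_eq_zero h
  obtain ⟨r, rfl⟩ := Nat.exists_eq_add_of_le ht
  rw [show t + r - t = r by omega] at hq
  zify at hq
  have e : (((t + 1) * K + (t + r + 2) - 1 : ℕ) : ℤ) =
      s + ((t + r + 2 : ℕ) : ℤ) * ((K : ℤ) + 1 - q) := by
    rw [Nat.add_sub_assoc (by omega)]
    push_cast [show t + r + 2 - 1 = t + r + 1 by omega]
    linear_combination (-1 : ℤ) * hq
  have h2 : ((((t + 1) * K + (t + r + 2) - 1) % (t + r + 2) : ℕ) : ℤ) = (s : ℤ) := by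
    rw [Int.natCast_mod, e, Int.add_mul_emod_self_left]
    exact Int.emod_eq_of_lt (by omega) (by omega)
  exact Int.ofNat.inj h2

theorem aux_main
    (k H : Type) [Field k] [Ring H] [HopfAlgebra k H] [FiniteDimensional k H]
    (S Sinv : H →ₗ[k] H) (hS : S = HopfAlgebra.antipode (R := k))
    (hSinv₁ : ∀ h : H, Sinv (S h) = h) (hSinv₂ : ∀ h : H, S (Sinv h) = h)
    (lam : H →ₗ[k] k) (Λ : H)
    (hΛ : ∀ h : H, h * Λ = Coalgebra.counit (R := k) h • Λ)
    (hlam : ∀ h : H,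
      (TensorProduct.lid k H) ((TensorProduct.map lam LinearMap.id)
        (Coalgebra.comul (R := k) h)) = lam h • (1 : H))
    (hnorm : lam Λ = 1)
    (N K : ℕ)
    (c : ℕ → ℤ) (hc : c (N + 2) = 0)
    (σ : Equiv.Perm (Fin (N + 1)))
    (hσ : ∀ t : Fin (N + 1), ((σ t : ℕ) + 1 + ((t : ℕ) + 1) * K) % (N + 2) = 0)
    (P : H →ₗ[k] H)
    (hP : ∀ (x : H) (m : ℕ) (L : Fin m → Fin (N + 1) → H),
      comulIter k H N x = ∑ i, nest k H N (L i) →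
      P x = ∑ i, (List.ofFn (fun t : Fin (N + 1) =>
        Spow k H S Sinv (2 * c ((σ t : ℕ) + 1)) (L i (σ t)))).prod)
    (m' : ℕ) (L' : Fin m' → Fin (N + 2) → H)
    (hrep : comulIter k H (N + 1) Λ = ∑ i, nest k H (N + 1) (L' i)) :
    (∑ i, lam ((List.ofFn (fun t : Fin (N + 2) =>
        Spow k H S Sinv (2 * c (lpr ((t : ℕ) * K) (N + 2)) + 1)
          (L' i ⟨((t : ℕ) * K + (N + 2) - 1) % (N + 2), Nat.mod_lt _ (by omega)⟩))).prod)) =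
      LinearMap.trace k H (S ∘ₗ P) := by
  classical
  let M1 : MultilinearMap k (fun _ : Fin (N + 1) => H) H :=
    MultilinearMap.domDomCongr σ ((MultilinearMap.mkPiAlgebraFin k (N + 1) H).compLinearMap
      (fun t => Spow k H S Sinv (2 * c ((σ t : ℕ) + 1))))
  have hM1 : ∀ f, M1 f = (List.ofFn (fun t : Fin (N + 1) =>
        Spow k H S Sinv (2 * c ((σ t : ℕ) + 1)) (f (σ t)))).prod := by
    intro f
    simp [M1, MultilinearMap.domDomCongr_apply, MultilinearMap.mkPiAlgebraFin_apply]
  let B : H →ₗ[k] H →ₗ[k] k :=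
    ((LinearMap.mul k H).compr₂ lam).flip.compl₂ S ∘ₗ S
  have hB : ∀ u h, B u h = lam (S h * S u) := fun u h => rfl
  let M2 : MultilinearMap k (fun _ : Fin (N + 2) => H) k := (B.compMultilinearMap M1).uncurryRight
  have hM2 : ∀ f : Fin (N + 2) → H, M2 f = lam (S (f (Fin.last _)) * S (M1 (Fin.init f))) :=
    fun f => rfl
  obtain ⟨T1, hT1⟩ := aux_lift k H H N
  obtain ⟨T2, hT2⟩ := aux_lift k H k (N + 1)
  obtain ⟨A, hA1, hA2⟩ := aux_app k H N
  have hPT : ∀ x, P x = T1 M1 (comulIter k H N x) := by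
    intro x
    obtain ⟨m, L, hL⟩ := aux_span k H N (comulIter k H N x)
    rw [hP x m L hL, hL, map_sum]
    exact Finset.sum_congr rfl fun i _ => by rw [hT1, hM1]
  have hTA : ∀ u h, T2 M2 (A (u ⊗ₜ[k] h)) = lam (S h * S (T1 M1 u)) := by
    intro u h
    obtain ⟨m, L, rfl⟩ := aux_span k H N u
    simp only [TensorProduct.sum_tmul, map_sum, Finset.mul_sum]
    refine Finset.sum_congr rfl fun i _ => ?_
    rw [hA1, hT2, hM2, hT1, Fin.snoc_last, Fin.init_snoc]
  have hlist : ∀ f : Fin (N + 2) → H, (List.ofFn (fun t : Fin (N + 2) =>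
        Spow k H S Sinv (2 * c (lpr ((t : ℕ) * K) (N + 2)) + 1)
          (f ⟨((t : ℕ) * K + (N + 2) - 1) % (N + 2), Nat.mod_lt _ (by omega)⟩))).prod =
      S (f (Fin.last _)) * S (M1 (Fin.init f)) := by
    intro f
    rw [hM1, aux_anti k H S hS, List.ofFn_succ, List.prod_cons]
    have e0 : ((0 : ℕ) * K + (N + 2) - 1) % (N + 2) = N + 1 := by
      rw [Nat.zero_mul, Nat.zero_add]
      exact Nat.mod_eq_of_lt (by omega)
    congr 1
    · rw [aux_Spow k H S Sinv hSinv₂]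
      have e1 : lpr (((0 : Fin (N + 2)) : ℕ) * K) (N + 2) = N + 2 := by
        unfold lpr
        rw [Fin.val_zero, e0]
      rw [e1, hc]
      have e2 : (⟨(((0 : Fin (N + 2)) : ℕ) * K + (N + 2) - 1) % (N + 2),
          Nat.mod_lt _ (by omega)⟩ : Fin (N + 2)) = Fin.last _ := by
        ext
        exact e0
      rw [e2]
      simp [Spow]
    · congr 2
      ext t
      rw [aux_Spow k H S Sinv hSinv₂]
      have h0 := hσ t.rev
      rw [Fin.val_rev] at h0
      have e1 := aux_mod N K (σ t.rev) t (by omega) (by omega)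
        (by rwa [show N + 1 - ((t : ℕ) + 1) + 1 = N - t + 1 by omega] at h0)
      have e2 : lpr ((t.succ : ℕ) * K) (N + 2) = (σ t.rev : ℕ) + 1 := by
        unfold lpr
        rw [Fin.val_succ, e1]
      have e3 : (⟨((t.succ : ℕ) * K + (N + 2) - 1) % (N + 2),
          Nat.mod_lt _ (by omega)⟩ : Fin (N + 2)) = (σ t.rev).castSucc := by
        ext
        exact e1
      rw [e2, e3]
      rfl
  rw [aux_radford k H S Sinv hS hSinv₁ hSinv₂ lam Λ hΛ hlam hnorm]
  have hL : ∀ i, lam ((List.ofFn (fun t : Fin (N + 2) =>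
        Spow k H S Sinv (2 * c (lpr ((t : ℕ) * K) (N + 2)) + 1)
          (L' i ⟨((t : ℕ) * K + (N + 2) - 1) % (N + 2), Nat.mod_lt _ (by omega)⟩))).prod) =
      T2 M2 (nest k H (N + 1) (L' i)) := by
    intro i
    rw [hlist, hT2, hM2]
  rw [Finset.sum_congr rfl fun i _ => hL i, ← map_sum, ← hrep, hA2,
    ← (Coalgebra.Repr.arbitrary k Λ).eq]
  simp only [map_sum, TensorProduct.map_tmul, LinearMap.id_apply, hTA, ← hPT, LinearMap.comp_apply]

theorem statement15
    (k H : Type) [Field k] [Ring H] [HopfAlgebra k H] [FiniteDimensional k H]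
    (S Sinv : H →ₗ[k] H) (hS : S = HopfAlgebra.antipode (R := k))
    (hSinv₁ : ∀ h : H, Sinv (S h) = h) (hSinv₂ : ∀ h : H, S (Sinv h) = h)
    (lam : H →ₗ[k] k) (Λ : H)
    (hΛ : ∀ h : H, h * Λ = Coalgebra.counit (R := k) h • Λ)
    (hlam : ∀ h : H,
      (TensorProduct.lid k H) ((TensorProduct.map lam LinearMap.id)
        (Coalgebra.comul (R := k) h)) = lam h • (1 : H))
    (hnorm : lam Λ = 1)
    (n K : ℕ) (hK : 0 < K) (hKn : K < n) (hcop : Nat.Coprime n K)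
    (hodd : Odd (n - K))
    -- the sequence (c_i) of Definition `d:cp` :
    (c : ℕ → ℤ) (hc : IsCSeq n K c)
    -- the permutation σ_{(n,−K)} ∈ Sym_{n−1}, σ(i) = −iK mod n
    -- (0-based on Fin (n-1) = Fin (n-2+1)) :
    (σ : Equiv.Perm (Fin (n - 2 + 1)))
    (hσ : ∀ t : Fin (n - 2 + 1), ((σ t : ℕ) + 1 + ((t : ℕ) + 1) * K) % n = 0)
    -- P^{(n,−K)} = m ∘ σ_{(n,−K)} ∘ (⨂ S^{2cᵢ}) ∘ Δ^{n−1} :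
    (P : H →ₗ[k] H)
    (hP : ∀ (x : H) (m : ℕ) (L : Fin m → Fin (n - 2 + 1) → H),
      comulIter k H (n - 2) x = ∑ i, nest k H (n - 2) (L i) →
      P x = ∑ i, (List.ofFn (fun t : Fin (n - 2 + 1) =>
        Spow k H S Sinv (2 * c ((σ t : ℕ) + 1)) (L i (σ t)))).prod)
    -- a finite-sum representation of Δⁿ(Λ) :
    (m' : ℕ) (L' : Fin m' → Fin (n - 1 + 1) → H)
    (hrep : comulIter k H (n - 1) Λ = ∑ i, nest k H (n - 1) (L' i)) :
    (∑ i, lam ((List.ofFn (fun t : Fin (n - 1 + 1) =>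
        Spow k H S Sinv (2 * c (lpr ((t : ℕ) * K) n) + 1)
          (L' i ⟨((t : ℕ) * K + n - 1) % n, by
            have := Nat.mod_lt ((t : ℕ) * K + n - 1) (show 0 < n by omega)
            omega⟩))).prod)) =
      LinearMap.trace k H (S ∘ₗ P) := by

  obtain ⟨N, rfl⟩ : ∃ N, n = N + 2 := ⟨n - 2, by omega⟩
  exact aux_main k H S Sinv hS hSinv₁ hSinv₂ lam Λ hΛ hlam hnorm N K c hc.1 σ hσ P hP m' L' hrep
end
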